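/- For all nonnegative integers g and p, the group AM_{g,1,p} is finitely presented: there exist a finite generating set and a finite set of relations presenting AM_{g,1,p}. -/

import Mathlib

/-- The generator `x_i` (for `1 ≤ i ≤ g`) of the free group of rank `n = 2g + p`. -/
def genX (g p : ℕ) (i : Fin g) : FreeGroup (Fin (2 * g + p)) :=
  FreeGroup.of ⟨2 * i, by have := i.isLt; omega⟩

/-- The generator `y_i` (for `1 ≤ i ≤ g`) of the free group of rank `n = 2g + p`. -/
def genY (g p : ℕ) (i : Fin g) : FreeGroup (Fin (2 * g + p)) :=
  FreeGroup.of ⟨2 * i + 1, by have := i.isLt; omega⟩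

/-- The generator `t_k` (for `1 ≤ k ≤ p`) of the free group of rank `n = 2g + p`. -/
def genT (g p : ℕ) (k : Fin p) : FreeGroup (Fin (2 * g + p)) :=
  FreeGroup.of ⟨2 * g + k, by have := k.isLt; omega⟩

/-- The boundary word `w₀ = [x₁,y₁][x₂,y₂]⋯[x_g,y_g]t₁t₂⋯t_p`,
where `[v,w] = v⁻¹w⁻¹vw`. -/
def boundaryWord (g p : ℕ) : FreeGroup (Fin (2 * g + p)) :=
  (List.ofFn fun i : Fin g =>
      (genX g p i)⁻¹ * (genY g p i)⁻¹ * genX g p i * genY g p i).prod *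
  (List.ofFn fun k : Fin p => genT g p k).prod

/-- The set of conjugacy classes `{[t₁⁻¹], [t₂⁻¹], …, [t_p⁻¹]}`. -/
def punctureClasses (g p : ℕ) : Set (ConjClasses (FreeGroup (Fin (2 * g + p)))) :=
  Set.range fun k : Fin p => ConjClasses.mk (genT g p k)⁻¹

/-- The set of automorphisms `φ` of `F_n` (`n = 2g + p`) fixing the boundary word `w₀`
and mapping the set of conjugacy classes `{[t₁⁻¹], …, [t_p⁻¹]}` onto itself. -/
def AMcarrier (g p : ℕ) : Set (MulAut (FreeGroup (Fin (2 * g + p)))) :=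
  {φ | φ (boundaryWord g p) = boundaryWord g p ∧
    ConjClasses.map φ.toMonoidHom '' punctureClasses g p = punctureClasses g p}

namespace Whitehead

open Pointwise

/-! ### Letters and half-spaces -/

section Letters

variable {α : Type}

/-- The formal inverse of a letter. -/
def bar (u : α × Bool) : α × Bool := (u.1, !u.2)

@[simp] theorem bar_bar (u : α × Bool) : bar (bar u) = u := by simp [bar]

theorem bar_ne (u : α × Bool) : bar u ≠ u := by
  obtain ⟨i, b⟩ := u
  cases b <;> simp [bar]

theorem bar_injective : Function.Injective (bar (α := α)) :=
  Function.LeftInverse.injective bar_bar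

theorem bar_eq_iff {u v : α × Bool} : bar u = v ↔ u = bar v :=
  ⟨fun h => by rw [← h, bar_bar], fun h => by rw [h, bar_bar]⟩

/-- The element of the free group represented by a letter. -/
def lt (u : α × Bool) : FreeGroup α := FreeGroup.mk [u]

@[simp] theorem lt_bar (u : α × Bool) : lt (bar u) = (lt u)⁻¹ := by
  simp [lt, bar, FreeGroup.inv_mk, FreeGroup.invRev]

theorem lt_true (i : α) : lt (i, true) = FreeGroup.of i := rfl

theorem lt_false (i : α) : lt (i, false) = (FreeGroup.of i)⁻¹ := by
  rw [← lt_true, ← lt_bar]; rfl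

theorem lt_mul_mk (u : α × Bool) (l : List (α × Bool)) :
    lt u * FreeGroup.mk l = FreeGroup.mk (u :: l) := by
  simp [lt]

theorem mk_mul_lt (u : α × Bool) (l : List (α × Bool)) :
    FreeGroup.mk l * lt u = FreeGroup.mk (l ++ [u]) := by
  simp [lt]

theorem hom_ext_letters {G : Type*} [Group G] {f g : FreeGroup α →* G}
    (h : ∀ u, f (lt u) = g (lt u)) : f = g :=
  FreeGroup.ext_hom _ _ fun i => h (i, true)

theorem letter_induction {C : FreeGroup α → Prop} (one : C 1)
    (mul : ∀ g u, C g → C (g * lt u)) (g : FreeGroup α) : C g := by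
  obtain ⟨l, rfl⟩ := Quot.exists_rep g
  change C (FreeGroup.mk l)
  induction l using List.reverseRecOn with
  | nil => exact one
  | append_singleton l u ih => rw [← mk_mul_lt]; exact mul _ _ ih

theorem isReduced_concat {l : List (α × Bool)} {u : α × Bool} :
    FreeGroup.IsReduced (l ++ [u]) ↔
      FreeGroup.IsReduced l ∧ ∀ v ∈ l.getLast?, v ≠ bar u := by
  unfold FreeGroup.IsReduced
  rw [List.isChain_append]
  refine and_congr_right fun _ => ?_
  simp only [List.isChain_singleton, List.head?_cons, true_and]
  refine forall₂_congr fun v _ => ?_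
  obtain ⟨i, b⟩ := u
  obtain ⟨j, c⟩ := v
  simp only [Option.mem_def, Option.some.injEq, forall_eq', bar, ne_eq, Prod.mk.injEq]
  cases b <;> cases c <;> simp

variable [DecidableEq α]

theorem lt_injective : Function.Injective (lt (α := α)) := by
  intro u v h
  have := congrArg FreeGroup.toWord h
  simpa [lt, FreeGroup.toWord_mk] using this

theorem lt_ne_one (u : α × Bool) : lt u ≠ 1 := by
  intro h
  have := congrArg FreeGroup.toWord h
  simp [lt, FreeGroup.toWord_mk] at this

theorem toWord_mk_of_isReduced {l : List (α × Bool)} (h : FreeGroup.IsReduced l) :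
    (FreeGroup.mk l).toWord = l := by
  rw [FreeGroup.toWord_mk, h.reduce_eq]

/-- The first letter of an element of the free group, `none` for the identity. -/
def hd (g : FreeGroup α) : Option (α × Bool) := g.toWord.head?

@[simp] theorem hd_one : hd (1 : FreeGroup α) = none := by simp [hd]

@[simp] theorem hd_lt (u : α × Bool) : hd (lt u) = some u := by
  simp [hd, lt, FreeGroup.toWord_mk]

theorem hd_eq_none {g : FreeGroup α} : hd g = none ↔ g = 1 := by
  simp [hd, List.head?_eq_none_iff, FreeGroup.toWord_eq_nil_iff]

theorem hd_mk {l : List (α × Bool)} (h : FreeGroup.IsReduced l) :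
    hd (FreeGroup.mk l) = l.head? := by
  rw [hd, toWord_mk_of_isReduced h]

/-- Right multiplication by a letter keeps the first letter, unless it starts or ends at the
identity. -/
theorem hd_mul_lt {g : FreeGroup α} {u : α × Bool} (h1 : g ≠ 1) (hu : g ≠ lt (bar u)) :
    hd (g * lt u) = hd g := by
  have hr : FreeGroup.IsReduced g.toWord := FreeGroup.isReduced_toWord
  have hg : FreeGroup.mk g.toWord = g := FreeGroup.mk_toWord
  generalize hl : g.toWord = l at hr hg
  rcases List.eq_nil_or_concat l with rfl | ⟨l', v, rfl⟩
  · exact absurd hg.symm h1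
  rw [List.concat_eq_append] at *
  have hl' : l' ≠ [] ∨ v ≠ bar u := by
    by_contra! hc
    obtain ⟨rfl, rfl⟩ := hc
    exact hu hg.symm
  have hhd : hd g = (l' ++ [v]).head? := by rw [hd, hl]
  by_cases hv : v = bar u
  · have hl'' := hl'.resolve_right (not_not.2 hv)
    have : g * lt u = FreeGroup.mk l' := by
      rw [← hg, ← mk_mul_lt, hv, lt_bar, inv_mul_cancel_right]
    rw [this, hd_mk (isReduced_concat.1 hr).1, hhd, List.head?_append_of_ne_nil _ hl'']
  · have hred : FreeGroup.IsReduced ((l' ++ [v]) ++ [u]) :=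
      isReduced_concat.2 ⟨hr, by simpa using hv⟩
    rw [← hg, mk_mul_lt, hd_mk hred, hd_mk hr, List.head?_append_of_ne_nil _ (by simp)]

/-- The set of elements whose first letter lies in `A`. -/
def S (A : Set (Option (α × Bool))) : Set (FreeGroup α) := {g | hd g ∈ A}

@[simp] theorem mem_S {A : Set (Option (α × Bool))} {g : FreeGroup α} : g ∈ S A ↔ hd g ∈ A :=
  Iff.rfl

theorem S_compl (A : Set (Option (α × Bool))) : S Aᶜ = (S A)ᶜ := rfl
theorem S_inter (A B : Set (Option (α × Bool))) : S (A ∩ B) = S A ∩ S B := rfl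
theorem S_union (A B : Set (Option (α × Bool))) : S (A ∪ B) = S A ∪ S B := rfl

/-- The half-space of elements whose first letter is `u`. -/
def H (u : α × Bool) : Set (FreeGroup α) := S {some u}

@[simp] theorem mem_H {u : α × Bool} {g : FreeGroup α} : g ∈ H u ↔ hd g = some u := Iff.rfl

theorem mem_H_mul_lt {u z : α × Bool} {g : FreeGroup α} (h1 : ¬(z = u ∧ g = 1))
    (h2 : ¬(z = bar u ∧ g = lt u)) : g ∈ H u ↔ g * lt z ∈ H u := by
  simp only [mem_H]
  by_cases hg : g = 1
  · subst hg
    simpa using fun h => h1 ⟨h, rfl⟩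
  by_cases hz : g = lt (bar z)
  · subst hz
    have : bar z ≠ u := by
      rintro rfl
      exact h2 ⟨by simp, rfl⟩
    rw [hd_lt, lt_bar, inv_mul_cancel]
    simpa using this
  · rw [hd_mul_lt hg hz]

theorem eq_H {u : α × Bool} {R : Set (FreeGroup α)} (h1 : (1 : FreeGroup α) ∉ R) (hu : lt u ∈ R)
    (h : ∀ z g, ¬(z = u ∧ g = 1) → ¬(z = bar u ∧ g = lt u) → (g ∈ R ↔ g * lt z ∈ R)) :
    R = H u := by
  have key : ∀ l : List (α × Bool), FreeGroup.IsReduced l →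
      (FreeGroup.mk l ∈ R ↔ l.head? = some u) := by
    intro l
    induction l using List.reverseRecOn with
    | nil => intro _; simpa [← FreeGroup.one_eq_mk] using h1
    | append_singleton l z ih =>
      intro hr
      have hr' := isReduced_concat.1 hr
      rw [← mk_mul_lt]
      by_cases hl : l = []
      · subst hl
        by_cases hz : z = u
        · subst hz
          simpa [← FreeGroup.one_eq_mk] using hu
        · have := h z 1 (fun h => hz h.1) (fun h => lt_ne_one _ h.2.symm)
          rw [← FreeGroup.one_eq_mk, ← this]
          simpa [hz] using h1
      · rw [← h z (FreeGroup.mk l), ih hr'.1, List.head?_append_of_ne_nil _ hl]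
        · rintro ⟨-, h⟩
          apply hl
          rw [← toWord_mk_of_isReduced hr'.1, h, FreeGroup.toWord_one]
        · rintro ⟨rfl, h⟩
          have : l = [u] := by
            rw [← toWord_mk_of_isReduced hr'.1, h, lt, toWord_mk_of_isReduced]
            exact List.isChain_singleton _
          subst this
          exact hr'.2 u (by simp) (by simp)
  ext g
  rw [mem_H, hd, ← key _ FreeGroup.isReduced_toWord, FreeGroup.mk_toWord]

theorem H_bar (u : α × Bool) : H (bar u) = (lt u)⁻¹ • (H u)ᶜ := by
  symm
  apply eq_H
  · rw [Set.mem_smul_set_iff_inv_smul_mem]; simp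
  · rw [Set.mem_smul_set_iff_inv_smul_mem]; simp
  · intro z g h1 h2
    rw [Set.mem_smul_set_iff_inv_smul_mem, Set.mem_smul_set_iff_inv_smul_mem]
    simp only [inv_inv, smul_eq_mul, Set.mem_compl_iff, ← mul_assoc]
    rw [not_iff_not]
    apply mem_H_mul_lt
    · rintro ⟨rfl, h⟩
      exact h2 ⟨by simp, by rw [lt_bar]; exact eq_inv_of_mul_eq_one_right h⟩
    · rintro ⟨rfl, h⟩
      exact h1 ⟨by simp, by simpa using h⟩

end Letters

/-! ### Almost invariant sets -/

section AI

variable {F : Type} [Group F]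

/-- The elements at which right multiplication by `w` changes membership in `S`. -/
def jump (w : F) (S : Set F) : Set F := {g | ¬(g ∈ S ↔ g * w ∈ S)}

/-- Almost invariant sets. -/
def AI (S : Set F) : Prop := ∀ w, (jump w S).Finite

theorem mem_jump {w g : F} {S : Set F} : g ∈ jump w S ↔ ¬(g ∈ S ↔ g * w ∈ S) := Iff.rfl

theorem jump_compl (w : F) (S : Set F) : jump w Sᶜ = jump w S := by
  ext g; simp only [mem_jump, Set.mem_compl_iff]; tauto

theorem jump_smul (g w : F) (S : Set F) : jump w (g • S) = g • jump w S := by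
  ext x
  simp only [mem_jump, Set.mem_smul_set_iff_inv_smul_mem, smul_eq_mul, mul_assoc]

theorem jump_aut (φ : MulAut F) (w : F) (S : Set F) : jump (φ w) (φ • S) = φ • jump w S := by
  ext x
  simp only [mem_jump, Set.mem_smul_set_iff_inv_smul_mem, MulAut.smul_def, map_mul,
    MulAut.inv_apply_self]

theorem jump_aut' (φ : MulAut F) (w : F) (S : Set F) : jump w (φ • S) = φ • jump (φ⁻¹ w) S := by
  rw [← jump_aut, MulAut.apply_inv_self]

theorem jump_mul_subset (v w : F) (S : Set F) :
    jump (v * w) S ⊆ jump v S ∪ (· * v) ⁻¹' jump w S := by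
  intro g
  simp only [mem_jump, Set.mem_union, Set.mem_preimage, mul_assoc]
  tauto

theorem jump_inter_subset (w : F) (A B : Set F) : jump w (A ∩ B) ⊆ jump w A ∪ jump w B := by
  intro g
  simp only [mem_jump, Set.mem_union, Set.mem_inter_iff]
  tauto

namespace AI

theorem compl {S : Set F} (h : AI S) : AI Sᶜ := fun w => by rw [jump_compl]; exact h w

theorem inter {A B : Set F} (hA : AI A) (hB : AI B) : AI (A ∩ B) :=
  fun w => ((hA w).union (hB w)).subset (jump_inter_subset w A B)

theorem union {A B : Set F} (hA : AI A) (hB : AI B) : AI (A ∪ B) := by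
  have := (hA.compl.inter hB.compl).compl
  rwa [← Set.compl_union, compl_compl] at this

theorem smul {S : Set F} (h : AI S) (g : F) : AI (g • S) := fun w => by
  rw [jump_smul]; exact (h w).smul_set

theorem aut {S : Set F} (h : AI S) (φ : MulAut F) : AI (φ • S) := fun w => by
  rw [jump_aut']; exact (h _).smul_set

end AI

theorem aut_smul_smul (φ : MulAut F) (g : F) (S : Set F) : φ • (g • S) = φ g • (φ • S) := by
  ext x
  simp only [Set.mem_smul_set_iff_inv_smul_mem, MulAut.smul_def, smul_eq_mul, map_mul, map_inv,
    MulAut.inv_apply_self]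

end AI

section AIFree

variable {α : Type}

theorem AI.of_letters {S : Set (FreeGroup α)} (h : ∀ u : α × Bool, (jump (lt u) S).Finite) :
    AI S := by
  intro w
  induction w using letter_induction with
  | one => simp [jump]
  | mul g u ih =>
    exact (ih.union ((h u).preimage (mul_left_injective g).injOn)).subset (jump_mul_subset _ _ _)

variable [DecidableEq α]

theorem jump_H (u z : α × Bool) : jump (lt z) (H u) ⊆ {1, lt u} := by
  intro g hg
  by_contra hc
  simp only [Set.mem_insert_iff, Set.mem_singleton_iff, not_or] at hc
  exact hg (mem_H_mul_lt (fun h => hc.1 h.2) (fun h => hc.2 h.2))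

theorem AI_H (u : α × Bool) : AI (H u) :=
  AI.of_letters fun z => (Set.toFinite _).subset (jump_H u z)

theorem AI_S (A : Set (Option (α × Bool))) : AI (S A) := by
  refine AI.of_letters fun z => (Set.toFinite {1, lt (bar z)}).subset ?_
  intro g hg
  by_contra hc
  simp only [Set.mem_insert_iff, Set.mem_singleton_iff, not_or] at hc
  exact hg (by simp only [mem_S, hd_mul_lt hc.1 hc.2])

end AIFree

end Whitehead

namespace Whitehead

open Pointwise

/-! ### Whitehead automorphisms -/

section Whitehead

variable {α : Type}

/-- Signed permutations of the basis. -/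
def SignedPerm : Subgroup (MulAut (FreeGroup α)) where
  carrier := {σ | ∃ π : Equiv.Perm (α × Bool), ∀ u, σ (lt u) = lt (π u)}
  one_mem' := ⟨1, fun u => rfl⟩
  mul_mem' := by
    rintro σ τ ⟨π, hπ⟩ ⟨ρ, hρ⟩
    exact ⟨π * ρ, fun u => by rw [MulAut.mul_apply, hρ, hπ]; rfl⟩
  inv_mem' := by
    rintro σ ⟨π, hπ⟩
    refine ⟨π.symm, fun u => ?_⟩
    obtain ⟨v, rfl⟩ := π.surjective u
    rw [← hπ, MulAut.inv_apply_self, Equiv.symm_apply_apply]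

theorem mulAut_ext_letters {σ τ : MulAut (FreeGroup α)} (h : ∀ u, σ (lt u) = τ (lt u)) :
    σ = τ := by
  have := hom_ext_letters (f := σ.toMonoidHom) (g := τ.toMonoidHom) h
  exact MulEquiv.ext fun g => DFunLike.congr_fun this g

variable [DecidableEq α]

theorem perm_bar {σ : MulAut (FreeGroup α)} {π : Equiv.Perm (α × Bool)}
    (h : ∀ u, σ (lt u) = lt (π u)) (u : α × Bool) : π (bar u) = bar (π u) := by
  apply lt_injective
  rw [← h, lt_bar, lt_bar, map_inv, h]

open Classical in
/-- The indicator of a proposition as an integer. -/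
noncomputable def ind (P : Prop) : ℤ := if P then 1 else 0

/-- The exponent with which the multiplier enters on the side of the letter `u`. -/
noncomputable def expo (A : Set (Option (α × Bool))) (u : α × Bool) : ℤ :=
  ind (some u ∈ A) - ind (none ∈ A)

/-- The endomorphism underlying a Whitehead automorphism. -/
noncomputable def whHom (A : Set (Option (α × Bool))) (a : α × Bool) :
    FreeGroup α →* FreeGroup α :=
  FreeGroup.lift fun i => if i = a.1 then FreeGroup.of i else
    (lt a ^ expo A (i, true))⁻¹ * FreeGroup.of i * lt a ^ expo A (i, false)

theorem whHom_self (A : Set (Option (α × Bool))) (a : α × Bool) : whHom A a (lt a) = lt a := by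
  obtain ⟨i, b⟩ := a
  cases b
  · rw [lt_false, map_inv, whHom, FreeGroup.lift_apply_of, if_pos rfl]
  · rw [lt_true, whHom, FreeGroup.lift_apply_of, if_pos rfl]

theorem whHom_lt (A : Set (Option (α × Bool))) {a u : α × Bool} (h : u ≠ a) (h' : u ≠ bar a) :
    whHom A a (lt u) = (lt a ^ expo A u)⁻¹ * lt u * lt a ^ expo A (bar u) := by
  have hne : u.1 ≠ a.1 := by
    obtain ⟨i, b⟩ := u
    obtain ⟨j, c⟩ := a
    rintro rfl
    cases b <;> cases c <;> simp_all [bar]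
  obtain ⟨i, b⟩ := u
  cases b
  · rw [lt_false, map_inv, whHom, FreeGroup.lift_apply_of, if_neg hne]
    simp [bar, mul_assoc]
  · rw [lt_true, whHom, FreeGroup.lift_apply_of, if_neg hne]
    simp [bar]

theorem whHom_comp (A : Set (Option (α × Bool))) (a : α × Bool) :
    (whHom A (bar a)).comp (whHom A a) = MonoidHom.id _ := by
  have hself : whHom A (bar a) (lt a) = lt a := by
    have := whHom_self A (bar a)
    rwa [lt_bar, map_inv, inv_inj] at this
  apply hom_ext_letters
  intro u
  rw [MonoidHom.comp_apply, MonoidHom.id_apply]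
  by_cases h : u = a
  · rw [h, whHom_self, hself]
  by_cases h' : u = bar a
  · rw [h', lt_bar, map_inv, map_inv, whHom_self, hself]
  rw [whHom_lt A h h', map_mul, map_mul, map_inv, map_zpow, map_zpow, hself,
    whHom_lt A h' (by rwa [bar_bar]), lt_bar]
  group

/-- The Whitehead automorphism attached to a set `A` of directions and a multiplier `a`. -/
noncomputable def wh (A : Set (Option (α × Bool))) (a : α × Bool) : MulAut (FreeGroup α) :=
  MonoidHom.toMulEquiv (whHom A a) (whHom A (bar a)) (whHom_comp A a)
    (by simpa using whHom_comp A (bar a))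

theorem wh_inv (A : Set (Option (α × Bool))) (a : α × Bool) : (wh A a)⁻¹ = wh A (bar a) :=
  MulEquiv.ext fun _ => rfl

theorem wh_self (A : Set (Option (α × Bool))) (a : α × Bool) : wh A a (lt a) = lt a :=
  whHom_self A a

theorem wh_lt (A : Set (Option (α × Bool))) {a u : α × Bool} (h : u ≠ a) (h' : u ≠ bar a) :
    wh A a (lt u) = (lt a ^ expo A u)⁻¹ * lt u * lt a ^ expo A (bar u) :=
  whHom_lt A h h'

theorem eq_wh {A : Set (Option (α × Bool))} {a : α × Bool} {τ : MulAut (FreeGroup α)}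
    (ha : τ (lt a) = lt a)
    (h : ∀ u, u ≠ a → u ≠ bar a →
      τ (lt u) = (lt a ^ expo A u)⁻¹ * lt u * lt a ^ expo A (bar u)) : τ = wh A a := by
  apply mulAut_ext_letters
  intro u
  by_cases hu : u = a
  · rw [hu, ha, wh_self]
  by_cases hu' : u = bar a
  · rw [hu', lt_bar, map_inv, map_inv, ha, wh_self]
  rw [h u hu hu', wh_lt A hu hu']

theorem wh_congr {A B : Set (Option (α × Bool))} {a : α × Bool}
    (h : ∀ o, o ≠ some a → o ≠ some (bar a) → (o ∈ A ↔ o ∈ B)) : wh A a = wh B a := by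
  have hn := h none (by simp) (by simp)
  have he : ∀ u, u ≠ a → u ≠ bar a → expo A u = expo B u := fun u hu hu' => by
    rw [expo, expo, hn, h (some u) (by simpa) (by simpa)]
  refine eq_wh (wh_self A a) fun u hu hu' => ?_
  rw [wh_lt A hu hu', he u hu hu', he (bar u) (by rwa [Ne, bar_eq_iff]) (by
    rwa [Ne, bar_injective.eq_iff])]

theorem ind_not (P : Prop) : ind (¬P) = 1 - ind P := by
  by_cases h : P <;> simp [ind, h]

theorem wh_compl (A : Set (Option (α × Bool))) (a : α × Bool) : wh Aᶜ (bar a) = wh A a := by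
  have hx : ∀ u, expo Aᶜ u = -expo A u := fun u => by
    simp only [expo, Set.mem_compl_iff, ind_not]; ring
  refine eq_wh ?_ fun u hu hu' => ?_
  · have := wh_self Aᶜ (bar a)
    rwa [lt_bar, map_inv, inv_inj] at this
  · rw [wh_lt _ hu' (by rwa [bar_bar]), hx, hx, lt_bar, zpow_neg, zpow_neg, inv_zpow, inv_zpow,
      inv_inv, inv_inv]

theorem wh_singleton (a : α × Bool) : wh {some a} a = 1 := by
  symm
  refine eq_wh rfl fun u hu hu' => ?_
  have : bar u ≠ a := by rwa [Ne, bar_eq_iff]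
  simp [expo, ind, hu, this]

theorem conj_wh {σ : MulAut (FreeGroup α)} {π : Equiv.Perm (α × Bool)}
    (h : ∀ u, σ (lt u) = lt (π u)) (A : Set (Option (α × Bool))) (a : α × Bool) :
    σ * wh A a * σ⁻¹ = wh {o | o.map π.symm ∈ A} (π a) := by
  have hi : ∀ u, σ⁻¹ (lt (π u)) = lt u := fun u => by rw [← h, MulAut.inv_apply_self]
  refine eq_wh ?_ fun u hu hu' => ?_
  · rw [MulAut.mul_apply, MulAut.mul_apply, hi, wh_self, h]
  · obtain ⟨u, rfl⟩ := π.surjective u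
    rw [MulAut.mul_apply, MulAut.mul_apply, hi, wh_lt A (by simpa using hu) (by
      rw [← perm_bar h] at hu'
      simpa using hu'), map_mul, map_mul, map_inv, map_zpow, map_zpow, h, h]
    have : ∀ v, expo {o | o.map π.symm ∈ A} (π v) = expo A v := fun v => by
      simp [expo]
    rw [this, ← perm_bar h, this]

/-- Two automorphisms are adjacent if they differ by a Whitehead automorphism followed by a
signed permutation. -/
def Edge (φ ψ : MulAut (FreeGroup α)) : Prop :=
  ∃ A a, ∃ σ ∈ SignedPerm, ψ = φ * wh A a * σ

theorem Edge.symm {φ ψ : MulAut (FreeGroup α)} (h : Edge φ ψ) : Edge ψ φ := by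
  obtain ⟨A, a, σ, hσ, rfl⟩ := h
  obtain ⟨π, hπ⟩ := SignedPerm.inv_mem hσ
  have := conj_wh hπ A (bar a)
  rw [inv_inv, ← wh_inv] at this
  refine ⟨{o | o.map π.symm ∈ A}, π (bar a), σ⁻¹, SignedPerm.inv_mem hσ, ?_⟩
  rw [← this]
  group

theorem Edge.mul_right {φ ψ σ : MulAut (FreeGroup α)} (h : Edge φ ψ) (hσ : σ ∈ SignedPerm) :
    Edge φ (ψ * σ) := by
  obtain ⟨A, a, τ, hτ, rfl⟩ := h
  exact ⟨A, a, _, mul_mem hτ hσ, by simp only [mul_assoc]⟩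

theorem Edge.mul_left {φ ψ : MulAut (FreeGroup α)} (h : Edge φ ψ) (g : MulAut (FreeGroup α)) :
    Edge (g * φ) (g * ψ) := by
  obtain ⟨A, a, σ, hσ, rfl⟩ := h
  exact ⟨A, a, σ, hσ, by simp only [mul_assoc]⟩

theorem edge_of_signedPerm [Nonempty α] {σ : MulAut (FreeGroup α)} (φ : MulAut (FreeGroup α))
    (hσ : σ ∈ SignedPerm) : Edge φ (φ * σ) := by
  obtain ⟨i⟩ := ‹Nonempty α›
  exact ⟨{some (i, true)}, (i, true), σ, hσ, by rw [wh_singleton, mul_one]⟩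

/-- Every edge has a representative whose multiplier is separated from its inverse. -/
theorem Edge.exists_normal {φ ψ : MulAut (FreeGroup α)} (h : Edge φ ψ) :
    ∃ A a, ∃ σ ∈ SignedPerm, some a ∈ A ∧ some (bar a) ∉ A ∧ ψ = φ * wh A a * σ := by
  obtain ⟨A, a, σ, hσ, rfl⟩ := h
  refine ⟨insert (some a) A \ {some (bar a)}, a, σ, hσ, ?_, by simp, ?_⟩
  · simpa using (bar_ne a).symm
  · congr 2
    apply wh_congr
    intro o h1 h2
    simp [h1, h2]

end Whitehead

/-! ### Submodular costs -/

section Cost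

/-- A translation-invariant submodular function on almost invariant sets. -/
structure Cost (F : Type) [Group F] (Γ : Type) [AddCommGroup Γ] [LinearOrder Γ] where
  /-- The underlying function. -/
  N : Set F → Γ
  smul : ∀ (g : F) (S : Set F), N (g • S) = N S
  compl : ∀ S, N Sᶜ = N S
  submod : ∀ A B, AI A → AI B → N (A ∩ B) + N (A ∪ B) ≤ N A + N B

variable {Γ : Type} [AddCommGroup Γ] [LinearOrder Γ]

/-- The cost obtained by transport along an automorphism. -/
def Cost.pull {F : Type} [Group F] (c : Cost F Γ) (φ : MulAut F) : Cost F Γ where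
  N S := c.N (φ • S)
  smul g S := by rw [aut_smul_smul, c.smul]
  compl S := by rw [Set.smul_set_compl, c.compl]
  submod A B hA hB := by
    rw [Set.smul_set_inter, Set.smul_set_union]
    exact c.submod _ _ (hA.aut φ) (hB.aut φ)

variable {α : Type} [DecidableEq α]

theorem Cost.N_H_bar (c : Cost (FreeGroup α) Γ) (u : α × Bool) : c.N (H (bar u)) = c.N (H u) := by
  rw [H_bar, c.smul, c.compl]

theorem smul_H {σ : MulAut (FreeGroup α)} {π : Equiv.Perm (α × Bool)}
    (h : ∀ u, σ (lt u) = lt (π u)) (u : α × Bool) : σ • H u = H (π u) := by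
  have hi : ∀ u, σ⁻¹ (lt (π u)) = lt u := fun u => by rw [← h, MulAut.inv_apply_self]
  have hi' : ∀ u, σ⁻¹ (lt u) = lt (π.symm u) := fun u => by
    rw [← hi (π.symm u), Equiv.apply_symm_apply]
  have hm : ∀ g, g ∈ σ • H u ↔ σ⁻¹ g ∈ H u := fun g => Set.mem_smul_set_iff_inv_smul_mem
  apply eq_H
  · rw [hm, map_one]; simp
  · rw [hm, hi]; simp
  · intro z g h1 h2
    rw [hm, hm, map_mul, hi']
    apply mem_H_mul_lt
    · rintro ⟨rfl, hg⟩
      exact h1 ⟨by simp, by simpa using hg⟩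
    · rintro ⟨hz, hg⟩
      refine h2 ⟨?_, by rw [← h, ← hg, MulAut.apply_inv_self]⟩
      rw [← perm_bar h, ← hz, Equiv.apply_symm_apply]

variable [Fintype α]

/-- The cost of an automorphism: the total cost of its half-spaces. -/
def Cost.val (c : Cost (FreeGroup α) Γ) (φ : MulAut (FreeGroup α)) : Γ :=
  ∑ u : α × Bool, c.N (φ • H u)

theorem Cost.val_pull (c : Cost (FreeGroup α) Γ) (φ ψ : MulAut (FreeGroup α)) :
    (c.pull φ).val ψ = c.val (φ * ψ) := by
  simp only [Cost.val, Cost.pull, mul_smul]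

theorem Cost.val_mul_signedPerm (c : Cost (FreeGroup α) Γ) (φ : MulAut (FreeGroup α))
    {σ : MulAut (FreeGroup α)} (hσ : σ ∈ SignedPerm) : c.val (φ * σ) = c.val φ := by
  obtain ⟨π, hπ⟩ := hσ
  unfold Cost.val
  rw [← Equiv.sum_comp π fun u => c.N (φ • H u)]
  exact Finset.sum_congr rfl fun u _ => by rw [mul_smul, smul_H hπ]

end Cost

end Whitehead

namespace Whitehead

open Pointwise

/-! ### Marked graphs -/

section MarkedGraph

/-- A graph whose oriented edges carry elements of the free group, and for every oriented edge
the half of the lifted vertex set lying beyond the lift of that edge starting at the identity. -/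
structure MG (α V E : Type) where
  /-- Edge reversal. -/
  rev : E → E
  rev_rev : ∀ e, rev (rev e) = e
  rev_ne : ∀ e, rev e ≠ e
  /-- The origin of an edge. -/
  vtx : E → V
  /-- The label of an edge. -/
  lab : E → FreeGroup α
  lab_rev : ∀ e, lab (rev e) = (lab e)⁻¹
  /-- The base vertex. -/
  base : V
  /-- The side of an edge. -/
  side : E → Set (FreeGroup α × V)
  side_iff : ∀ e h g, ¬(h = e ∧ g = 1) → ¬(h = rev e ∧ g = lab e) →
    ((g, vtx h) ∈ side e ↔ (g * lab h, vtx (rev h)) ∈ side e)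
  side_self : ∀ e, (1, vtx e) ∉ side e
  side_rev : ∀ e, (lab e, vtx (rev e)) ∈ side e

variable {α V E : Type} (M : MG α V E)

/-- The set of group elements on the side of an edge. -/
def MG.half (e : E) : Set (FreeGroup α) := {g | (g, M.base) ∈ M.side e}

/-- The automorphism `φ` is obtained from the marked graph by collapsing the maximal tree formed
by the edges outside the range of `ι`. -/
structure Realizes (ι : α × Bool → E) (φ : MulAut (FreeGroup α)) : Prop where
  inj : Function.Injective ι
  rev : ∀ u, ι (bar u) = M.rev (ι u)
  conn : ∀ χ : V → Prop, (∀ h, h ∉ Set.range ι → (χ (M.vtx h) ↔ χ (M.vtx (M.rev h)))) →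
    ∀ v w, χ v ↔ χ w
  pot : ∃ P : V → FreeGroup α, P M.base = 1 ∧
    (∀ h, h ∉ Set.range ι → P (M.vtx h) * M.lab h = P (M.vtx (M.rev h))) ∧
    ∀ u, φ (lt u) = P (M.vtx (ι u)) * M.lab (ι u) * (P (M.vtx (M.rev (ι u))))⁻¹

variable {M} {ι ι' : α × Bool → E} {φ φ' : MulAut (FreeGroup α)}

theorem Realizes.rev_notMem_range (h : Realizes M ι φ) {e : E} (he : e ∉ Set.range ι) :
    M.rev e ∉ Set.range ι := by
  rintro ⟨u, hu⟩
  exact he ⟨bar u, by rw [h.rev, hu, M.rev_rev]⟩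

theorem Realizes.exists_signedPerm (h : Realizes M ι φ) (h' : Realizes M ι' φ')
    (hr : Set.range ι = Set.range ι') : ∃ σ ∈ SignedPerm, φ' = φ * σ := by
  obtain ⟨P, hP1, hP, hPφ⟩ := h.pot
  obtain ⟨P', hP'1, hP', hPφ'⟩ := h'.pot
  have hPP : ∀ v, P v = P' v := fun v => by
    refine (h.conn (fun v => P v = P' v) (fun e he => ?_) v M.base).2 (hP1.trans hP'1.symm)
    rw [← hP e he, ← hP' e (hr ▸ he), mul_left_inj]
  let π : Equiv.Perm (α × Bool) := (Equiv.ofInjective ι' h'.inj).trans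
    ((Equiv.setCongr hr.symm).trans (Equiv.ofInjective ι h.inj).symm)
  have hπ : ∀ u, ι (π u) = ι' u := fun u => Equiv.apply_ofInjective_symm h.inj _
  refine ⟨φ⁻¹ * φ', ⟨π, fun u => ?_⟩, by simp⟩
  rw [MulAut.mul_apply, hPφ', MulAut.inv_apply, MulEquiv.symm_apply_eq, hPφ, hπ, hPP, hPP]

variable [DecidableEq α]

theorem Realizes.smul_H (h : Realizes M ι φ) (u : α × Bool) :
    ∃ p : FreeGroup α, φ • H u = p • M.half (ι u) := by
  obtain ⟨P, hP1, hP, hPφ⟩ := h.pot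
  set e := ι u with he
  let Q : FreeGroup α → V → Prop := fun g v => ((P (M.vtx e))⁻¹ * φ g * P v, v) ∈ M.side e
  have hQ : ∀ g v w, Q g v ↔ Q g w := by
    intro g
    apply h.conn
    intro f hf
    have hne : f ≠ e := fun hfe => hf ⟨u, (hfe.trans he).symm⟩
    have hne' : f ≠ M.rev e := fun hfe => hf ⟨bar u, by rw [h.rev, hfe]⟩
    simp only [Q]
    rw [M.side_iff e f _ (fun hc => hne hc.1) (fun hc => hne' hc.1), mul_assoc, hP f hf]
  have hR : {g | Q g M.base} = H u := by
    apply eq_H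
    · rw [Set.mem_ofPred_eq, hQ 1 _ (M.vtx e)]
      simpa [Q] using M.side_self e
    · rw [Set.mem_ofPred_eq, hQ _ _ (M.vtx (M.rev e))]
      simpa [Q, hPφ, ← he, mul_assoc] using M.side_rev e
    · intro z g h1 h2
      rw [Set.mem_ofPred_eq, Set.mem_ofPred_eq, hQ g _ (M.vtx (ι z)),
        hQ (g * lt z) _ (M.vtx (M.rev (ι z)))]
      simp only [Q]
      rw [M.side_iff e (ι z), map_mul, hPφ z]
      · simp [mul_assoc]
      · rintro ⟨hz, hg⟩
        refine h1 ⟨h.inj hz, ?_⟩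
        rw [hz, mul_assoc, inv_mul_eq_one, right_eq_mul] at hg
        rwa [map_eq_one_iff _ φ.injective] at hg
      · rintro ⟨hz, hg⟩
        refine h2 ⟨h.inj (hz.trans (h.rev u).symm), ?_⟩
        rw [hz] at hg
        apply φ.injective
        rw [hPφ u, ← he, ← hg]
        group
  refine ⟨P (M.vtx e), ?_⟩
  rw [← hR]
  ext g
  simp [Set.mem_smul_set_iff_inv_smul_mem, Q, MG.half, hP1]

theorem ind_true {P : Prop} (h : P) : ind P = 1 := by simp [ind, h]
theorem ind_false {P : Prop} (h : ¬P) : ind P = 0 := by simp [ind, h]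
theorem ind_congr {P Q : Prop} (h : P ↔ Q) : ind P = ind Q := by
  rw [propext h]

/-- Exchange an edge of the maximal tree for the edge `ι a`. -/
def exch (M : MG α V E) (ι : α × Bool → E) (a : α × Bool) (e : E) (u : α × Bool) : E :=
  if u = a then M.rev e else if u = bar a then e else ι u

theorem exch_self (a : α × Bool) (e : E) : exch M ι a e a = M.rev e := by simp [exch]

theorem exch_bar (a : α × Bool) (e : E) : exch M ι a e (bar a) = e := by
  simp [exch, bar_ne]

theorem exch_of_ne {a u : α × Bool} (e : E) (h : u ≠ a) (h' : u ≠ bar a) :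
    exch M ι a e u = ι u := by simp [exch, h, h']

theorem Realizes.exch_aux (h : Realizes M ι φ) {e : E} (he : e ∉ Set.range ι) {a : α × Bool}
    {χ : V → Prop}
    (hχ : ∀ f, f ∉ Set.range ι → f ≠ e → f ≠ M.rev e → (χ (M.vtx f) ↔ χ (M.vtx (M.rev f))))
    (he1 : χ (M.vtx e)) (he2 : ¬χ (M.vtx (M.rev e)))
    (ha1 : χ (M.vtx (ι a))) (ha2 : ¬χ (M.vtx (M.rev (ι a)))) {A : Set (Option (α × Bool))}
    (hA : ∀ o, o ∈ A ↔ χ (o.elim M.base fun u => M.vtx (ι u))) :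
    Realizes M (exch M ι a e) (φ * wh A a) := by
  obtain ⟨P, hP1, hP, hPφ⟩ := h.pot
  have hre := h.rev_notMem_range he
  refine ⟨?_, ?_, ?_, ?_⟩
  · intro u v huv
    simp only [exch] at huv
    split_ifs at huv with h1 h2 h3 h4 h5 h6 h7 h8
    · exact h1.trans h2.symm
    · exact absurd huv (M.rev_ne e)
    · exact absurd ⟨v, huv.symm⟩ hre
    · exact absurd huv.symm (M.rev_ne e)
    · exact h4.trans h6.symm
    · exact absurd ⟨v, huv.symm⟩ he
    · exact absurd ⟨u, huv⟩ hre
    · exact absurd ⟨u, huv⟩ he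
    · exact h.inj huv
  · intro u
    by_cases h1 : u = a
    · rw [h1, exch_self, exch_bar, M.rev_rev]
    by_cases h2 : u = bar a
    · rw [h2, bar_bar, exch_self, exch_bar]
    rw [exch_of_ne e h1 h2, exch_of_ne e, h.rev]
    · rwa [Ne, bar_eq_iff]
    · rwa [Ne, bar_injective.eq_iff]
  · intro χ' hχ'
    have hT : ∀ f, f ∉ Set.range ι → f ≠ e → f ≠ M.rev e →
        (χ' (M.vtx f) ↔ χ' (M.vtx (M.rev f))) := by
      intro f hf h1 h2
      apply hχ'
      rintro ⟨u, rfl⟩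
      simp only [exch] at h1 h2 hf
      split_ifs at h1 h2 hf
      · exact h2 rfl
      · exact h1 rfl
      · exact hf ⟨u, rfl⟩
    have ha : χ' (M.vtx (ι a)) ↔ χ' (M.vtx (M.rev (ι a))) := by
      apply hχ'
      rintro ⟨u, hu⟩
      simp only [exch] at hu
      split_ifs at hu with h1 h2
      · exact hre ⟨a, hu.symm⟩
      · exact he ⟨a, hu.symm⟩
      · exact h1 (h.inj hu)
    by_cases hc : χ' (M.vtx e) ↔ χ' (M.vtx (M.rev e))
    · refine h.conn χ' fun f hf => ?_
      by_cases h1 : f = e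
      · rwa [h1]
      by_cases h2 : f = M.rev e
      · rw [h2, M.rev_rev]; exact hc.symm
      exact hT f hf h1 h2
    · have := h.conn (fun v => (χ' v ↔ χ v)) fun f hf => by
        by_cases h1 : f = e
        · rw [h1]; tauto
        by_cases h2 : f = M.rev e
        · rw [h2, M.rev_rev]; tauto
        rw [hT f hf h1 h2, hχ f hf h1 h2]
      have h3 := this (M.vtx (ι a)) (M.vtx (M.rev (ι a)))
      tauto
  · set b := φ (lt a) with hb
    have hba : (b * P (M.vtx (M.rev (ι a)))) = P (M.vtx (ι a)) * M.lab (ι a) := by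
      rw [hb, hPφ a, inv_mul_cancel_right]
    refine ⟨fun v => (b ^ (ind (χ v) - ind (χ M.base)))⁻¹ * P v, by simp [hP1], ?_, ?_⟩
    · intro f hf
      simp only
      by_cases hfr : f ∈ Set.range ι
      · obtain ⟨u, rfl⟩ := hfr
        have hu : u = a ∨ u = bar a := by
          by_contra! hc
          exact hf ⟨u, exch_of_ne e hc.1 hc.2⟩
        rcases hu with rfl | rfl
        · rw [ind_true ha1, ind_false ha2, mul_assoc, ← hba]
          group
        · rw [h.rev, M.rev_rev, ind_true ha1, ind_false ha2, M.lab_rev, mul_assoc,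
            eq_mul_inv_of_mul_eq hba.symm]
          group
      · have h1 : f ≠ e := by
          rintro rfl
          exact hf ⟨bar a, exch_bar a _⟩
        have h2 : f ≠ M.rev e := by
          rintro rfl
          exact hf ⟨a, exch_self a e⟩
        rw [ind_congr (hχ f hfr h1 h2), mul_assoc, hP f hfr]
    · intro u
      have hself : ∀ A, (φ * wh A a) (lt a) = b := fun A => by rw [MulAut.mul_apply, wh_self]
      have hee := hP e he
      simp only
      by_cases h1 : u = a
      · rw [h1, hself, exch_self, M.rev_rev, ind_true he1, ind_false he2, M.lab_rev, ← hee]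
        group
      by_cases h2 : u = bar a
      · rw [h2, lt_bar, map_inv, hself, exch_bar, ind_true he1, ind_false he2, ← hee]
        group
      rw [MulAut.mul_apply, wh_lt _ h1 h2, map_mul, map_mul, map_inv, map_zpow, map_zpow, ← hb,
        exch_of_ne e h1 h2, hPφ u]
      simp only [expo, hA, Option.elim_some, Option.elim_none, h.rev]
      group

theorem range_exch (h : Realizes M ι φ) (a : α × Bool) (e : E) :
    Set.range (exch M ι a e) = (Set.range ι \ {ι a, M.rev (ι a)}) ∪ {e, M.rev e} := by
  ext f
  simp only [Set.mem_range, Set.mem_union, Set.mem_sdiff, Set.mem_insert_iff,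
    Set.mem_singleton_iff]
  constructor
  · rintro ⟨u, rfl⟩
    by_cases h1 : u = a
    · rw [h1, exch_self]; simp
    by_cases h2 : u = bar a
    · rw [h2, exch_bar]; simp
    rw [exch_of_ne e h1 h2, ← h.rev, h.inj.eq_iff, h.inj.eq_iff]
    simp [h1, h2]
  · rintro (⟨⟨u, rfl⟩, hu⟩ | rfl | rfl)
    · rw [← h.rev, h.inj.eq_iff, h.inj.eq_iff, not_or] at hu
      exact ⟨u, exch_of_ne e hu.1 hu.2⟩
    · exact ⟨bar a, exch_bar a _⟩
    · exact ⟨a, exch_self a e⟩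

theorem Realizes.val [Fintype α] {Γ : Type} [AddCommGroup Γ] [LinearOrder Γ]
    (h : Realizes M ι φ) (c : Cost (FreeGroup α) Γ) :
    c.val φ = ∑ u, c.N (M.half (ι u)) := by
  refine Finset.sum_congr rfl fun u _ => ?_
  obtain ⟨p, hp⟩ := h.smul_H u
  rw [hp, c.smul]

/-- The exchange lemma: an edge of the tree may be exchanged for an edge outside it that joins the
two components left after removing the first one. -/
theorem Realizes.exchange (h : Realizes M ι φ) {e : E} (he : e ∉ Set.range ι) (a : α × Bool)
    (χ : V → Prop)
    (hχ : ∀ f, f ∉ Set.range ι → f ≠ e → f ≠ M.rev e → (χ (M.vtx f) ↔ χ (M.vtx (M.rev f))))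
    (hse : ¬(χ (M.vtx e) ↔ χ (M.vtx (M.rev e))))
    (hsa : ¬(χ (M.vtx (ι a)) ↔ χ (M.vtx (M.rev (ι a))))) :
    ∃ ι' φ', Realizes M ι' φ' ∧ Edge φ φ' ∧
      Set.range ι' = (Set.range ι \ {ι a, M.rev (ι a)}) ∪ {e, M.rev e} ∧
      (ι' = exch M ι a e ∨ ι' = exch M ι a (M.rev e)) := by
  have hre := h.rev_notMem_range he
  have main : ∀ (a' : α × Bool) (e' : E), (a' = a ∨ a' = bar a) → (e' = e ∨ e' = M.rev e) →
      χ (M.vtx e') → ¬χ (M.vtx (M.rev e')) → χ (M.vtx (ι a')) → ¬χ (M.vtx (M.rev (ι a'))) →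
      ∃ ι' φ', Realizes M ι' φ' ∧ Edge φ φ' ∧
        Set.range ι' = (Set.range ι \ {ι a, M.rev (ι a)}) ∪ {e, M.rev e} ∧
        (ι' = exch M ι a e ∨ ι' = exch M ι a (M.rev e)) := by
    intro a' e' ha' he' h1 h2 h3 h4
    have he'r : e' ∉ Set.range ι := by rcases he' with rfl | rfl <;> assumption
    have hA := h.exch_aux (A := {o | χ (o.elim M.base fun u => M.vtx (ι u))}) he'r (fun f hf hf1 hf2 => hχ f hf
      (by rcases he' with rfl | rfl
          · exact hf1
          · rwa [M.rev_rev] at hf2)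
      (by rcases he' with rfl | rfl
          · exact hf2
          · exact hf1)) h1 h2 h3 h4 (fun _ => Iff.rfl)
    refine ⟨_, _, hA, ⟨_, a', 1, one_mem _, (mul_one _).symm⟩, ?_, ?_⟩
    · rw [range_exch h]
      rcases ha' with rfl | rfl <;> rcases he' with rfl | rfl <;>
        simp only [h.rev, M.rev_rev, Set.pair_comm]
    · have hswap : ∀ f, exch M ι (bar a) f = exch M ι a (M.rev f) := by
        intro f
        funext u
        by_cases h1 : u = a
        · rw [h1, exch_self, M.rev_rev]
          have := exch_bar (M := M) (ι := ι) (bar a) f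
          rwa [bar_bar] at this
        by_cases h2 : u = bar a
        · rw [h2, exch_self, exch_bar]
        rw [exch_of_ne _ h2 (by rwa [bar_bar]), exch_of_ne _ h1 h2]
      rcases ha' with rfl | rfl <;> rcases he' with rfl | rfl <;>
        simp [hswap, M.rev_rev]
  by_cases h1 : χ (M.vtx e) <;> by_cases h3 : χ (M.vtx (ι a))
  · exact main a e (Or.inl rfl) (Or.inl rfl) h1 (by tauto) h3 (by tauto)
  · exact main (bar a) e (Or.inr rfl) (Or.inl rfl) h1 (by tauto) (by rw [h.rev]; tauto)
      (by rw [h.rev, M.rev_rev]; tauto)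
  · exact main a (M.rev e) (Or.inl rfl) (Or.inr rfl) (by tauto) (by rw [M.rev_rev]; tauto) h3
      (by tauto)
  · exact main (bar a) (M.rev e) (Or.inr rfl) (Or.inr rfl) (by tauto) (by rw [M.rev_rev]; tauto)
      (by rw [h.rev]; tauto) (by rw [h.rev, M.rev_rev]; tauto)

theorem Realizes.edge (h : Realizes M ι φ) {e : E} (he : e ∉ Set.range ι) (a : α × Bool)
    (χ : V → Prop)
    (hχ : ∀ f, f ∉ Set.range ι → f ≠ e → f ≠ M.rev e → (χ (M.vtx f) ↔ χ (M.vtx (M.rev f))))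
    (hse : ¬(χ (M.vtx e) ↔ χ (M.vtx (M.rev e))))
    (hsa : ¬(χ (M.vtx (ι a)) ↔ χ (M.vtx (M.rev (ι a))))) (h' : Realizes M ι' φ')
    (hr : Set.range ι' = (Set.range ι \ {ι a, M.rev (ι a)}) ∪ {e, M.rev e}) : Edge φ φ' := by
  obtain ⟨ι₂, φ₂, h₂, hE, hr₂, -⟩ := h.exchange he a χ hχ hse hsa
  obtain ⟨σ, hσ, rfl⟩ := h₂.exists_signedPerm h' (hr₂.trans hr.symm)
  exact hE.mul_right hσ

theorem sum_half_exch [Fintype α] {Γ : Type} [AddCommGroup Γ] {ι' : α × Bool → E} (n : E → Γ)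
    (hn : ∀ e, n (M.rev e) = n e) (hι : ∀ u, ι (bar u) = M.rev (ι u)) {a : α × Bool} {e : E}
    (h : ι' = exch M ι a e ∨ ι' = exch M ι a (M.rev e)) :
    ∑ u, n (ι' u) = ∑ u, n (ι u) - (n (ι a) + n (ι a)) + (n e + n e) := by
  have : ∑ u, (n (ι' u) - n (ι u)) = (n e - n (ι a)) + (n e - n (ι a)) := by
    rw [Fintype.sum_eq_add a (bar a) (bar_ne a).symm]
    · rcases h with rfl | rfl <;> simp [exch_self, exch_bar, hn, hι]
    · rintro u ⟨h1, h2⟩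
      rcases h with rfl | rfl <;> simp [exch_of_ne _ h1 h2]
  rw [Finset.sum_sub_distrib] at this
  rw [sub_eq_iff_eq_add.1 this]
  abel

end MarkedGraph

end Whitehead

namespace Whitehead

open Pointwise

/-! ### The graph with three vertices attached to two disjoint sets of directions -/

section Tri

/-- The three vertices. -/
inductive Tri
  | l | m | r

variable {α : Type}

open Classical in
/-- The vertex at which a direction is attached. -/
noncomputable def posn (A B : Set (Option (α × Bool))) (o : Option (α × Bool)) : Tri :=
  if o ∈ A then .l else if o ∈ B then .r else .m

theorem posn_eq_l {A B : Set (Option (α × Bool))} {o : Option (α × Bool)} :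
    posn A B o = .l ↔ o ∈ A := by
  unfold posn; split_ifs <;> simp [*]

theorem posn_eq_r {A B : Set (Option (α × Bool))} (h : Disjoint A B) {o : Option (α × Bool)} :
    posn A B o = .r ↔ o ∈ B := by
  unfold posn
  split_ifs with h1 h2
  · simpa using fun h2 => Set.disjoint_left.1 h h1 h2
  · simp [h2]
  · simp [h2]

/-- The outer vertex of one of the two extra edges. -/
def outer (s : Bool) : Tri := if s then .r else .l

variable [DecidableEq α]

open Classical in
/-- The direction of a lifted vertex as seen from the identity. -/
noncomputable def hat (A B : Set (Option (α × Bool))) (x : FreeGroup α × Tri) : Tri :=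
  if x.1 = 1 then x.2 else posn A B (hd x.1)

/-- The graph obtained from the rose by expanding its vertex into a path with three vertices. -/
noncomputable def tri (A B : Set (Option (α × Bool))) :
    MG α Tri ((α × Bool) ⊕ (Bool × Bool)) where
  rev e := e.map bar fun x => (x.1, !x.2)
  rev_rev e := by rcases e with u | ⟨s, o⟩ <;> simp
  rev_ne e := by rcases e with u | ⟨s, o⟩ <;> simp [bar_ne]
  vtx e := e.elim (fun u => posn A B (some u)) fun x => if x.2 then .m else outer x.1
  lab e := e.elim lt fun _ => 1
  lab_rev e := by rcases e with u | ⟨s, o⟩ <;> simp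
  base := posn A B none
  side e := e.elim (fun u => {x | hd x.1 = some u})
    fun y => {x | hat A B x = outer y.1 ↔ y.2 = true}
  side_iff := by
    have hhat : ∀ (g : FreeGroup α) z, hat A B (g, posn A B (some z)) =
        hat A B (g * lt z, posn A B (some (bar z))) := by
      intro g z
      by_cases h1 : g = 1
      · subst h1
        simp [hat, lt_ne_one]
      by_cases h2 : g = lt (bar z)
      · have : g * lt z = 1 := by rw [h2, lt_bar, inv_mul_cancel]
        rw [hat, if_neg h1, hat, if_pos this, h2, hd_lt]
      · have : g * lt z ≠ 1 := fun h => h2 (by rw [lt_bar]; exact eq_inv_of_mul_eq_one_left h)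
        rw [hat, if_neg h1, hat, if_neg this, hd_mul_lt h1 h2]
    rintro (u | ⟨s, o⟩) (z | ⟨s', o'⟩) g h1 h2
    · exact mem_H_mul_lt (u := u) (by simpa using h1) (by simpa using h2)
    · simp
    · simpa using by rw [hhat]
    · simp only [Sum.elim_inr, mul_one, Set.mem_ofPred_eq, Sum.map_inr]
      by_cases hg : g = 1
      · subst hg
        revert h1 h2
        cases s <;> cases o <;> cases s' <;> cases o' <;> simp [hat, outer]
      · simp [hat, hg]
  side_self := by
    rintro (u | ⟨s, o⟩)
    · simp
    · cases s <;> cases o <;> simp [hat, outer]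
  side_rev := by
    rintro (u | ⟨s, o⟩)
    · simp
    · cases s <;> cases o <;> simp [hat, outer]

variable (A B : Set (Option (α × Bool)))

@[simp] theorem tri_rev_inl (u : α × Bool) : (tri A B).rev (.inl u) = .inl (bar u) := rfl
@[simp] theorem tri_rev_inr (s o : Bool) : (tri A B).rev (.inr (s, o)) = .inr (s, !o) := rfl
@[simp] theorem tri_vtx_inl (u : α × Bool) : (tri A B).vtx (.inl u) = posn A B (some u) := rfl
@[simp] theorem tri_vtx_inr_true (s : Bool) : (tri A B).vtx (.inr (s, true)) = .m := rfl
@[simp] theorem tri_vtx_inr_false (s : Bool) : (tri A B).vtx (.inr (s, false)) = outer s := rfl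

theorem tri_half_inl (u : α × Bool) : (tri A B).half (.inl u) = H u := rfl

theorem hat_base (g : FreeGroup α) : hat A B (g, posn A B none) = posn A B (hd g) := by
  by_cases h : g = 1
  · subst h; simp [hat]
  · simp [hat, h]

theorem tri_half_left : (tri A B).half (.inr (false, true)) = S A := by
  ext g
  change (hat A B (g, posn A B none) = outer false ↔ true = true) ↔ _
  rw [hat_base]
  simp [outer, posn_eq_l]

variable {A B}

theorem tri_half_right (h : Disjoint A B) : (tri A B).half (.inr (true, true)) = S B := by
  ext g
  change (hat A B (g, posn A B none) = outer true ↔ true = true) ↔ _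
  rw [hat_base]
  simp [outer, posn_eq_r h]

theorem tri_half_rev (s o : Bool) :
    (tri A B).half (.inr (s, !o)) = ((tri A B).half (.inr (s, o)))ᶜ := by
  ext g
  change (hat A B (g, posn A B none) = outer s ↔ (!o) = true) ↔
    ¬(hat A B (g, posn A B none) = outer s ↔ o = true)
  cases o <;> simp

theorem tri_realizes_one : Realizes (tri A B) Sum.inl 1 where
  inj := Sum.inl_injective
  rev u := rfl
  conn χ hχ := by
    have h1 := hχ (.inr (false, true)) (by simp)
    have h2 := hχ (.inr (true, true)) (by simp)
    simp only [tri_vtx_inr_true, tri_rev_inr, Bool.not_true, tri_vtx_inr_false, outer,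
      Bool.false_eq_true, if_false, if_true] at h1 h2
    rintro (_ | _ | _) (_ | _ | _) <;> tauto
  pot := ⟨fun _ => 1, rfl, by
    rintro (u | ⟨s, o⟩) h
    · simp at h
    · simp [tri], fun u => by simp [tri]⟩

theorem tri_realizes_left {a : α × Bool} (ha : some a ∈ A) (ha' : some (bar a) ∉ A) :
    Realizes (tri A B) (exch (tri A B) Sum.inl a (.inr (false, false))) (wh A a) := by
  have := (tri_realizes_one (A := A) (B := B)).exch_aux (e := .inr (false, false)) (by simp)
    (a := a) (χ := fun v => v = .l) (A := A) ?_ (by simp [outer]) (by simp)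
    (by simpa [posn_eq_l]) (by simpa [posn_eq_l]) ?_
  · rwa [one_mul] at this
  · rintro (u | ⟨s, o⟩) h h1 h2
    · simp at h
    · cases s <;> cases o <;> simp_all [outer]
  · rintro (_ | u)
    · exact posn_eq_l.symm
    · exact posn_eq_l.symm

theorem tri_realizes_right (hd : Disjoint A B) {b : α × Bool} (hb : some b ∈ B)
    (hb' : some (bar b) ∉ B) :
    Realizes (tri A B) (exch (tri A B) Sum.inl b (.inr (true, false))) (wh B b) := by
  have := (tri_realizes_one (A := A) (B := B)).exch_aux (e := .inr (true, false)) (by simp)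
    (a := b) (χ := fun v => v = .r) (A := B) ?_ (by simp [outer]) (by simp)
    (by simpa [posn_eq_r hd]) (by simpa [posn_eq_r hd]) ?_
  · rwa [one_mul] at this
  · rintro (u | ⟨s, o⟩) h h1 h2
    · simp at h
    · cases s <;> cases o <;> simp_all [outer]
  · rintro (_ | u)
    · exact (posn_eq_r hd).symm
    · exact (posn_eq_r hd).symm

theorem tri_range (a : α × Bool) (s o : Bool) {f : (α × Bool) ⊕ (Bool × Bool)} :
    f ∈ Set.range (exch (tri A B) Sum.inl a (.inr (s, o))) ↔
      f.elim (fun u => u ≠ a ∧ u ≠ bar a) (fun x => x.1 = s) := by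
  rw [range_exch tri_realizes_one]
  rcases f with u | ⟨s', o'⟩
  · simp
  · cases s <;> cases s' <;> cases o <;> cases o' <;> simp

end Tri

section Peak

variable {α : Type} [DecidableEq α] {Γ : Type} [AddCommGroup Γ] [LinearOrder Γ]
  {A B : Set (Option (α × Bool))}

theorem Cost.tri_rev (c : Cost (FreeGroup α) Γ) (e : (α × Bool) ⊕ (Bool × Bool)) :
    c.N ((tri A B).half ((tri A B).rev e)) = c.N ((tri A B).half e) := by
  rcases e with u | ⟨s, o⟩
  · exact c.N_H_bar u
  · rw [tri_rev_inr, tri_half_rev, c.compl]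

variable [Fintype α]

theorem Cost.val_wh (c : Cost (FreeGroup α) Γ) {a : α × Bool} (ha : some a ∈ A)
    (ha' : some (bar a) ∉ A) : c.val (wh A a) =
      c.val 1 - (c.N (H a) + c.N (H a)) + (c.N (S A) + c.N (S A)) := by
  rw [(tri_realizes_left (B := ∅) ha ha').val, (tri_realizes_one (A := A) (B := ∅)).val,
    sum_half_exch (fun e => c.N ((tri A ∅).half e)) c.tri_rev (fun _ => rfl) (Or.inl rfl)]
  have : c.N ((tri A ∅).half (.inr (false, false))) = c.N (S A) := by
    rw [← tri_half_left A ∅, ← c.tri_rev]; rfl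
  rw [this]
  rfl

end Peak

end Whitehead

namespace Whitehead

open Pointwise

/-! ### Peak reduction -/

/-- Walks of a given length all of whose vertices except possibly the last satisfy `P`. -/
inductive Walk {V : Type} (Adj : V → V → Prop) (P : V → Prop) : ℕ → V → V → Prop
  | nil (v : V) : Walk Adj P 0 v v
  | cons {n : ℕ} {u v w : V} : P u → Adj u v → Walk Adj P n v w → Walk Adj P (n + 1) u w

namespace Walk

variable {V W : Type} {Adj : V → V → Prop} {P Q : V → Prop}

theorem append {n k : ℕ} {u v w : V} (h : Walk Adj P n u v) (h' : Walk Adj P k v w) :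
    Walk Adj P (n + k) u w := by
  induction h with
  | nil => simpa using h'
  | cons hP ha _ ih => rw [Nat.add_right_comm]; exact cons hP ha (ih h')

theorem single {u v : V} (hu : P u) (h : Adj u v) : Walk Adj P 1 u v := cons hu h (nil v)

theorem map {Adj' : W → W → Prop} {Q : W → Prop} (f : V → W) (hA : ∀ u v, Adj u v → Adj' (f u) (f v))
    (hP : ∀ v, P v → Q (f v)) {n : ℕ} {u v : V} (h : Walk Adj P n u v) :
    Walk Adj' Q n (f u) (f v) := by
  induction h with
  | nil => exact nil _
  | cons h1 h2 _ ih => exact cons (hP _ h1) (hA _ _ h2) ih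

theorem mono (hP : ∀ v, P v → Q v) {n : ℕ} {u v : V} (h : Walk Adj P n u v) :
    Walk Adj Q n u v := h.map id (fun _ _ => id) hP

end Walk

section Peak

variable {α : Type} [DecidableEq α] [Fintype α] {Γ : Type} [AddCommGroup Γ] [LinearOrder Γ]
  [IsOrderedAddMonoid Γ] {A B : Set (Option (α × Bool))} {a b : α × Bool}

/-- Peak reduction in the disjoint case. -/
theorem peak_disjoint (c : Cost (FreeGroup α) Γ) (hd : Disjoint A B)
    (ha : some a ∈ A) (ha' : some (bar a) ∉ A) (hb : some b ∈ B) (hb' : some (bar b) ∉ B)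
    (hA : c.N (S A) < c.N (H a)) (hB : c.N (S B) ≤ c.N (H b)) :
    ∃ n ≤ 2, Walk Edge (fun φ => c.val φ < c.val 1) n (wh A a) (wh B b) := by
  have hab : some a ∉ B := Set.disjoint_left.1 hd ha
  have hba : some b ∉ A := Set.disjoint_right.1 hd hb
  have hne : b ≠ a := by rintro rfl; exact hab hb
  have hne' : bar b ≠ bar a := fun h => hne (bar_injective h)
  have r1 := tri_realizes_left (B := B) ha ha'
  have r2 := tri_realizes_right (A := A) hd hb hb'
  have hlow : c.val (wh A a) < c.val 1 := by
    rw [c.val_wh ha ha']; grind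
  by_cases h1 : bar a = b
  · refine ⟨1, by norm_num, .single hlow ?_⟩
    subst h1
    refine r1.edge (e := .inr (true, true)) (by rw [tri_range]; simp) a (fun v => v = .m) ?_
      (by simp [outer]) (by simp [exch_self, outer]) r2 ?_
    · rintro (u | ⟨s, o⟩) h h1 h2
      · simp only [tri_range, Sum.elim_inl] at h
        have : u = a ∨ u = bar a := by tauto
        rcases this with rfl | rfl <;> simp [posn, ha, hb, ha']
      · simp only [tri_range, Sum.elim_inr] at h
        cases s <;> cases o <;> simp_all
    · ext f
      simp only [Set.mem_union, Set.mem_sdiff, tri_range, exch_self]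
      rcases f with u | ⟨s, o⟩
      · simp [and_comm]
      · cases s <;> cases o <;> simp
  have h1' : a ≠ bar b := fun h => h1 (by rw [h, bar_bar])
  by_cases h2 : some (bar a) ∉ B ∨ some (bar b) ∉ A
  · have := r1.exchange (e := .inr (true, true)) (by rw [tri_range]; simp) b
      (fun v => (some (bar a) ∈ B → v = .m) ∧ (some (bar a) ∉ B → v = .r)) ?_
      (by by_cases some (bar a) ∈ B <;> simp [outer, *]) ?_
    rotate_left
    · rintro (u | ⟨s, o⟩) h h3 h4
      · simp only [tri_range, Sum.elim_inl] at h
        have : u = a ∨ u = bar a := by tauto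
        rcases this with rfl | rfl <;> simp only [tri_vtx_inl, tri_rev_inl, bar_bar, posn] <;>
          split_ifs <;> simp_all
      · simp only [tri_range, Sum.elim_inr] at h
        cases s <;> cases o <;> simp_all
    · rw [exch_of_ne _ hne (fun h => h1 h.symm)]
      simp only [tri_vtx_inl, tri_rev_inl, posn]
      split_ifs <;> simp_all
    obtain ⟨ι, φ, r3, hE, hr, hι⟩ := this
    refine ⟨2, le_rfl, .cons hlow hE (.single ?_ ?_)⟩
    · rw [r3.val c, sum_half_exch (fun e => c.N ((tri A B).half e)) c.tri_rev r1.rev hι,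
        ← r1.val, c.val_wh ha ha', tri_half_right hd, exch_of_ne _ hne (fun h => h1 h.symm),
        tri_half_inl]
      grind
    · refine (r2.edge (e := .inr (false, true)) (by rw [tri_range]; simp) a
        (fun v => (some (bar b) ∈ A → v = .m) ∧ (some (bar b) ∉ A → v = .l)) ?_
        (by by_cases some (bar b) ∈ A <;> simp [outer, *]) ?_ r3 ?_).symm
      · rintro (u | ⟨s, o⟩) h h3 h4
        · simp only [tri_range, Sum.elim_inl] at h
          have : u = b ∨ u = bar b := by tauto
          rcases this with rfl | rfl <;> simp only [tri_vtx_inl, tri_rev_inl, bar_bar, posn] <;>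
            split_ifs <;> simp_all
        · simp only [tri_range, Sum.elim_inr] at h
          cases s <;> cases o <;> simp_all
      · rw [exch_of_ne _ hne.symm h1']
        simp only [tri_vtx_inl, tri_rev_inl, posn]
        split_ifs <;> simp_all
      · rw [hr, exch_of_ne _ hne.symm h1', exch_of_ne _ hne (fun h => h1 h.symm)]
        ext f
        simp only [Set.mem_union, Set.mem_sdiff, tri_range]
        rcases f with u | ⟨s, o⟩
        · simp; tauto
        · cases s <;> cases o <;> simp
  push Not at h2
  obtain ⟨h2, h3⟩ := h2
  by_cases h4 : c.N (S A) < c.N (H b)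
  · have r4 := tri_realizes_left (B := B) h3 (by simpa using hba)
    refine ⟨2, le_rfl, .cons (v := wh A (bar b)) hlow ?_ (.single ?_ (Edge.symm ?_))⟩
    · refine r1.edge (e := .inl a) (by rw [tri_range]; simp) b (fun v => v = .l) ?_ ?_ ?_ r4 ?_
      · rintro (u | ⟨s, o⟩) h h5 h6
        · simp only [tri_range, Sum.elim_inl] at h
          simp_all
        · simp only [tri_range, Sum.elim_inr] at h
          cases s <;> cases o <;> simp_all [outer]
      · simp [posn_eq_l, ha, ha']
      · rw [exch_of_ne _ hne (fun h => h1 h.symm)]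
        simp [posn_eq_l, hba, h3]
      · rw [exch_of_ne _ hne (fun h => h1 h.symm)]
        ext f
        simp only [Set.mem_union, Set.mem_sdiff, tri_range]
        rcases f with u | ⟨s, o⟩
        · by_cases u = a <;> by_cases u = bar a <;> simp_all <;> grind
        · cases s <;> cases o <;> simp
    · rw [c.val_wh h3 (by simpa using hba), c.N_H_bar]; grind
    · refine r2.edge (e := .inr (false, true)) (by rw [tri_range]; simp) b (fun v => v = .m) ?_
        (by simp [outer]) (by simp [exch_self, outer]) r4 ?_
      · rintro (u | ⟨s, o⟩) h h5 h6
        · simp only [tri_range, Sum.elim_inl] at h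
          have : u = b ∨ u = bar b := by tauto
          rcases this with rfl | rfl <;> simp [posn, hb, hba, h3]
        · simp only [tri_range, Sum.elim_inr] at h
          cases s <;> cases o <;> simp_all
      · rw [exch_self]
        ext f
        simp only [Set.mem_union, Set.mem_sdiff, tri_range]
        rcases f with u | ⟨s, o⟩
        · simp [and_comm]
        · cases s <;> cases o <;> simp
  · have h4' : c.N (S B) < c.N (H a) := by grind
    have r4 := tri_realizes_right (A := A) hd h2 (by simpa using hab)
    refine ⟨2, le_rfl, .cons (v := wh B (bar a)) hlow ?_ (.single ?_ (Edge.symm ?_))⟩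
    · refine r1.edge (e := .inr (true, true)) (by rw [tri_range]; simp) a (fun v => v = .m) ?_
        (by simp [outer]) (by simp [exch_self, outer]) r4 ?_
      · rintro (u | ⟨s, o⟩) h h5 h6
        · simp only [tri_range, Sum.elim_inl] at h
          have : u = a ∨ u = bar a := by tauto
          rcases this with rfl | rfl <;> simp [posn, ha, ha', h2]
        · simp only [tri_range, Sum.elim_inr] at h
          cases s <;> cases o <;> simp_all
      · rw [exch_self]
        ext f
        simp only [Set.mem_union, Set.mem_sdiff, tri_range]
        rcases f with u | ⟨s, o⟩
        · simp [and_comm]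
        · cases s <;> cases o <;> simp
    · rw [c.val_wh h2 (by simpa using hab), c.N_H_bar]; grind
    · refine r2.edge (e := .inl b) (by rw [tri_range]; simp) a (fun v => v = .r) ?_ ?_ ?_ r4 ?_
      · rintro (u | ⟨s, o⟩) h h5 h6
        · simp only [tri_range, Sum.elim_inl] at h
          simp_all
        · simp only [tri_range, Sum.elim_inr] at h
          cases s <;> cases o <;> simp_all [outer]
      · simp [posn_eq_r hd, hb, hb']
      · rw [exch_of_ne _ hne.symm h1']
        simp [posn_eq_r hd, hab, h2]
      · rw [exch_of_ne _ hne.symm h1']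
        ext f
        simp only [Set.mem_union, Set.mem_sdiff, tri_range]
        rcases f with u | ⟨s, o⟩
        · by_cases u = b <;> by_cases u = bar b <;> simp_all <;> grind
        · cases s <;> cases o <;> simp

end Peak

end Whitehead

namespace Whitehead

open Pointwise

theorem Cost.N_S_compl {α : Type} [DecidableEq α] {Γ : Type} [AddCommGroup Γ] [LinearOrder Γ]
    (c : Cost (FreeGroup α) Γ) (A : Set (Option (α × Bool))) : c.N (S Aᶜ) = c.N (S A) := by
  rw [S_compl, c.compl]

section Peak

variable {α : Type} [DecidableEq α] [Fintype α] {Γ : Type} [AddCommGroup Γ] [LinearOrder Γ]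
  [IsOrderedAddMonoid Γ] {A B : Set (Option (α × Bool))} {a b : α × Bool}

/-- Peak reduction in the nested case. -/
theorem peak_nested (c : Cost (FreeGroup α) Γ)
    (hd : Disjoint A B ∨ Disjoint A Bᶜ ∨ Disjoint Aᶜ B ∨ Disjoint Aᶜ Bᶜ)
    (ha : some a ∈ A) (ha' : some (bar a) ∉ A) (hb : some b ∈ B) (hb' : some (bar b) ∉ B)
    (hA : c.N (S A) < c.N (H a)) (hB : c.N (S B) ≤ c.N (H b)) :
    ∃ n ≤ 2, Walk Edge (fun φ => c.val φ < c.val 1) n (wh A a) (wh B b) := by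
  rw [← c.N_H_bar, ← c.N_S_compl] at hA hB
  rcases hd with hd | hd | hd | hd
  · rw [c.N_H_bar, c.N_S_compl] at hA hB
    exact peak_disjoint c hd ha ha' hb hb' hA hB
  · rw [c.N_H_bar, c.N_S_compl] at hA
    rw [← wh_compl B]
    exact peak_disjoint c hd ha ha' hb' (by simpa using hb) hA hB
  · rw [c.N_H_bar, c.N_S_compl] at hB
    rw [← wh_compl A]
    exact peak_disjoint c hd ha' (by simpa using ha) hb hb' hA hB
  · rw [← wh_compl A, ← wh_compl B]
    exact peak_disjoint c hd ha' (by simpa using ha) hb' (by simpa using hb) hA hB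

/-- Peak reduction at the identity, for normalised Whitehead automorphisms. -/
theorem peak_wh (c : Cost (FreeGroup α) Γ)
    (ha : some a ∈ A) (ha' : some (bar a) ∉ A) (hb : some b ∈ B) (hb' : some (bar b) ∉ B)
    (hA : c.N (S A) < c.N (H a)) (hB : c.N (S B) ≤ c.N (H b)) :
    ∃ n ≤ 4, Walk Edge (fun φ => c.val φ < c.val 1) n (wh A a) (wh B b) := by
  obtain ⟨C, d, hd, hd', hC, hCA, hCB⟩ : ∃ C d, some d ∈ C ∧ some (bar d) ∉ C ∧
      c.N (S C) < c.N (H d) ∧ (Disjoint A C ∨ Disjoint A Cᶜ ∨ Disjoint Aᶜ C ∨ Disjoint Aᶜ Cᶜ) ∧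
      (Disjoint C B ∨ Disjoint C Bᶜ ∨ Disjoint Cᶜ B ∨ Disjoint Cᶜ Bᶜ) := by
    by_contra! h
    have key : ∀ A' B', (A' = A ∨ A' = Aᶜ) → (B' = B ∨ B' = Bᶜ) → ∀ d, some d ∈ A' ∩ B' →
        some (bar d) ∉ A' ∩ B' → c.N (H d) ≤ c.N (S (A' ∩ B')) := by
      intro A' B' hA' hB' d hd hd'
      by_contra! hlt
      have h1 : Disjoint A (A' ∩ B') ∨ Disjoint Aᶜ (A' ∩ B') := by
        rcases hA' with rfl | rfl
        · exact .inr (disjoint_compl_left.mono_right Set.inter_subset_left)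
        · exact .inl (disjoint_compl_right.mono_right Set.inter_subset_left)
      have h2 : Disjoint (A' ∩ B') B ∨ Disjoint (A' ∩ B') Bᶜ := by
        rcases hB' with rfl | rfl
        · exact .inr (disjoint_compl_right.mono_left Set.inter_subset_right)
        · exact .inl (disjoint_compl_left.mono_left Set.inter_subset_right)
      have h3 := h _ d hd hd' hlt (by tauto)
      tauto
    have s1 := c.submod (S A) (S B) (AI_S A) (AI_S B)
    have s2 := c.submod (S A) (S Bᶜ) (AI_S A) (AI_S Bᶜ)
    rw [← c.compl (S A ∪ _), Set.compl_union, ← S_compl, ← S_compl, ← S_inter, ← S_inter] at s1 s2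
    rw [c.N_S_compl B, compl_compl] at s2
    have k11 := key A B (.inl rfl) (.inl rfl)
    have k10 := key A Bᶜ (.inl rfl) (.inr rfl)
    have k01 := key Aᶜ B (.inr rfl) (.inl rfl)
    have k00 := key Aᶜ Bᶜ (.inr rfl) (.inr rfl)
    have ea := c.N_H_bar a
    have eb := c.N_H_bar b
    simp only [Set.mem_inter_iff, Set.mem_compl_iff] at k11 k10 k01 k00
    by_cases p1 : some a ∈ B <;> by_cases p2 : some (bar a) ∈ B <;> by_cases p3 : some b ∈ A <;>
      by_cases p4 : some (bar b) ∈ A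
    all_goals
      have a11 := k11 a
      have a10 := k10 a
      have a01 := k01 (bar a)
      have a00 := k00 (bar a)
      have b11 := k11 b
      have b10 := k10 (bar b)
      have b01 := k01 b
      have b00 := k00 (bar b)
      simp only [p1, p2, p3, p4, ha, ha', hb, hb', bar_bar, ea, eb, not_true, not_false_iff,
        and_true, and_false, true_imp_iff, false_imp_iff] at a11 a10 a01 a00 b11 b10 b01 b00
      clear k11 k10 k01 k00 key h
      grind
  obtain ⟨n, hn, w⟩ := peak_nested c hCA ha ha' hd hd' hA hC.le
  obtain ⟨k, hk, w'⟩ := peak_nested c hCB hd hd' hb hb' hC hB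
  exact ⟨n + k, by omega, w.append w'⟩

/-- Peak reduction: below a common neighbour `φ`, two neighbours of `φ` one of which is lower
and the other not higher are joined by a short walk which stays below `φ`. -/
theorem peak [Nonempty α] (c : Cost (FreeGroup α) Γ) {φ u v : MulAut (FreeGroup α)}
    (hu : Edge φ u) (hv : Edge φ v) (hcu : c.val u < c.val φ) (hcv : c.val v ≤ c.val φ) :
    ∃ n ≤ 6, Walk Edge (fun ψ => c.val ψ < c.val φ) n u v := by
  obtain ⟨A, a, σ, hσ, ha, ha', rfl⟩ := hu.exists_normal
  obtain ⟨B, b, τ, hτ, hb, hb', rfl⟩ := hv.exists_normal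
  rw [c.val_mul_signedPerm _ hσ] at hcu
  rw [c.val_mul_signedPerm _ hτ] at hcv
  have e1 : (c.pull φ).val 1 = c.val φ := by rw [c.val_pull, mul_one]
  have h1 := (c.pull φ).val_wh ha ha'
  have h2 := (c.pull φ).val_wh hb hb'
  rw [c.val_pull, e1] at h1 h2
  have hA : (c.pull φ).N (S A) < (c.pull φ).N (H a) := by grind
  have hB : (c.pull φ).N (S B) ≤ (c.pull φ).N (H b) := by grind
  obtain ⟨n, hn, w⟩ := peak_wh (c.pull φ) ha ha' hb hb' hA hB
  have w' : Walk Edge (fun ψ => c.val ψ < c.val φ) n (φ * wh A a) (φ * wh B b) :=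
    w.map (φ * ·) (fun _ _ h => h.mul_left φ) fun ψ h => by rwa [c.val_pull, e1] at h
  have w0 : Walk Edge (fun ψ => c.val ψ < c.val φ) 1 (φ * wh A a * σ) (φ * wh A a) :=
    .single (by rwa [c.val_mul_signedPerm _ hσ]) (edge_of_signedPerm _ hσ).symm
  rcases hcv.lt_or_eq with hlt | heq
  · exact ⟨1 + n + 1, by omega, (w0.append w').append (.single hlt (edge_of_signedPerm _ hτ))⟩
  · have hlast : ∀ {n u v}, Walk Edge (fun ψ => c.val ψ < c.val φ) n u v → c.val u < c.val φ →
        c.val v = c.val φ → Walk Edge (fun ψ => c.val ψ < c.val φ) n u (v * τ) := by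
      intro n u v w hu hv
      induction w with
      | nil => exact absurd hv hu.ne
      | cons h1 h2 h3 ih =>
        cases h3 with
        | nil => exact .single h1 (h2.mul_right hτ)
        | cons h4 h5 h6 => exact .cons h1 h2 (ih h4 hv)
    exact ⟨1 + n, by omega, w0.append (hlast w' hcu heq)⟩

end Peak

end Whitehead

namespace Whitehead

/-! ### Descent and cocycles on graphs with peak reduction -/

section Morse

variable {V : Type} {Adj : V → V → Prop} {Γ : Type} [LinearOrder Γ] {f : V → Γ}

/-- The graph induced on the vertices satisfying `P`. -/
def Within (Adj : V → V → Prop) (P : V → Prop) (u v : V) : Prop := Adj u v ∧ P u ∧ P v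

theorem Within.mono {P Q : V → Prop} (hPQ : ∀ v, P v → Q v) {u v : V}
    (h : Relation.ReflTransGen (Within Adj P) u v) :
    Relation.ReflTransGen (Within Adj Q) u v :=
  Relation.ReflTransGen.mono (fun _ _ h => ⟨h.1, hPQ _ h.2.1, hPQ _ h.2.2⟩) _ _ h

theorem Walk.within {P Q : V → Prop} (hPQ : ∀ v, P v → Q v) {n : ℕ} {u v : V}
    (h : Walk Adj P n u v) (hv : Q v) : Relation.ReflTransGen (Within Adj Q) u v := by
  induction h with
  | nil => exact .refl
  | cons h1 h2 h3 ih =>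
    refine .head ⟨h2, hPQ _ h1, ?_⟩ (ih hv)
    cases h3 with
    | nil => exact hv
    | cons h _ _ => exact hPQ _ h

/-- Peak reduction of length `N` for the function `f` on a graph. -/
def HasPeaks (Adj : V → V → Prop) (f : V → Γ) (N : ℕ) : Prop :=
  ∀ φ u v, Adj φ u → Adj φ v → f u < f φ → f v ≤ f φ →
    ∃ n ≤ N, Walk Adj (fun ψ => f ψ < f φ) n u v

theorem Walk.exists_last {P : V → Prop} {n : ℕ} {u v : V} (h : Walk Adj P n u v) (hne : u ≠ v) :
    ∃ x, P x ∧ Adj x v ∧ Relation.ReflTransGen (Within Adj P) u x := by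
  induction h with
  | nil => exact absurd rfl hne
  | @cons n u x w h1 h2 h3 ih =>
    by_cases hx : x = w
    · subst hx
      exact ⟨u, h1, h2, .refl⟩
    · obtain ⟨y, hy, hy', hr⟩ := ih hx
      refine ⟨y, hy, hy', .head ⟨h2, h1, ?_⟩ hr⟩
      cases h3 with
      | nil => exact absurd rfl hx
      | cons h _ _ => exact h

variable {N : ℕ} {b₀ : V}

theorem HasPeaks.aux (hp : HasPeaks Adj f N) (hs : ∀ u v, Adj u v → Adj v u) {m : Γ}
    (hb : f b₀ < m) {v : V} (h : Relation.ReflTransGen (Within Adj (f · ≤ m)) b₀ v) :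
    (f v < m → Relation.ReflTransGen (Within Adj (f · < m)) b₀ v) ∧
    (f v = m → ∃ u, Adj v u ∧ f u < m ∧ Relation.ReflTransGen (Within Adj (f · < m)) b₀ u) := by
  induction h with
  | refl => exact ⟨fun _ => .refl, fun h => absurd h hb.ne⟩
  | @tail v w _ h2 ih =>
    obtain ⟨hvw, hv, hw⟩ := h2
    rcases hv.lt_or_eq with hv | hv
    · have := ih.1 hv
      exact ⟨fun hw => this.tail ⟨hvw, hv, hw⟩, fun _ => ⟨v, hs _ _ hvw, hv, this⟩⟩
    · obtain ⟨u, hvu, hu, hbu⟩ := ih.2 hv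
      subst hv
      obtain ⟨n, -, hwalk⟩ := hp v u w hvu hvw hu hw
      refine ⟨fun hw => hbu.trans (hwalk.within (fun _ => id) hw), fun hw => ?_⟩
      obtain ⟨x, hx, hxw, hr⟩ := hwalk.exists_last (by rintro rfl; exact hu.ne hw)
      exact ⟨x, hs _ _ hxw, hx, hbu.trans hr⟩

theorem exists_level {m : V} {u v : V} (hu : f u < f m)
    (h : Relation.ReflTransGen (Within Adj (f · < f m)) u v) :
    ∃ m', f m' < f m ∧ Relation.ReflTransGen (Within Adj (f · ≤ f m')) u v := by
  induction h with
  | refl => exact ⟨u, hu, .refl⟩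
  | @tail v w _ h2 ih =>
    obtain ⟨m', hm', hr⟩ := ih
    have key : ∀ x, f x < f m → f v ≤ f x → f w ≤ f x → f m' ≤ f x →
        ∃ m', f m' < f m ∧ Relation.ReflTransGen (Within Adj (f · ≤ f m')) u w :=
      fun x hx h1 h3 h4 => ⟨x, hx, (Within.mono (fun _ h => h.trans h4) hr).tail ⟨h2.1, h1, h3⟩⟩
    rcases le_total (f v) (f w) with h | h
    · rcases le_total (f w) (f m') with h' | h'
      · exact key m' hm' (h.trans h') h' le_rfl
      · exact key w h2.2.2 h le_rfl h'
    · rcases le_total (f v) (f m') with h' | h'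
      · exact key m' hm' h' (h.trans h') le_rfl
      · exact key v h2.2.1 le_rfl h h'

theorem HasPeaks.within (hp : HasPeaks Adj f N) (hs : ∀ u v, Adj u v → Adj v u)
    (hf : WellFounded fun u v => f u < f v) (hb : ∀ v, f b₀ ≤ f v)
    {v : V} (h : Relation.ReflTransGen Adj b₀ v) :
    Relation.ReflTransGen (Within Adj (f · ≤ f v)) b₀ v := by
  have h0 : ∃ m, Relation.ReflTransGen (Within Adj (f · ≤ f m)) b₀ v := by
    induction h with
    | refl => exact ⟨b₀, .refl⟩
    | @tail v w _ h2 ih =>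
      obtain ⟨m, hm⟩ := ih
      have key : ∀ x, f m ≤ f x → f v ≤ f x → f w ≤ f x →
          Relation.ReflTransGen (Within Adj (f · ≤ f x)) b₀ w := fun x h1 h3 h4 =>
        (Within.mono (fun _ h => h.trans h1) hm).tail ⟨h2, h3, h4⟩
      rcases le_total (f v) (f w) with h | h
      · rcases le_total (f w) (f m) with h' | h'
        · exact ⟨m, key m le_rfl (h.trans h') h'⟩
        · exact ⟨w, key w h' h le_rfl⟩
      · rcases le_total (f v) (f m) with h' | h'
        · exact ⟨m, key m le_rfl h' (h.trans h')⟩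
        · exact ⟨v, key v h' le_rfl h⟩
  obtain ⟨m, hm⟩ := h0
  induction m using hf.induction with
  | h m ih =>
    rcases le_or_gt (f m) (f v) with h | h
    · exact Within.mono (fun _ h' => h'.trans h) hm
    · have hbm := (hb v).trans_lt h
      obtain ⟨m', hm', hr⟩ := exists_level hbm ((hp.aux hs hbm hm).1 h)
      exact ih m' hm' hr

theorem HasPeaks.exists_lower (hp : HasPeaks Adj f N) (hs : ∀ u v, Adj u v → Adj v u)
    (hf : WellFounded fun u v => f u < f v) (hb : ∀ v, f b₀ ≤ f v)
    {v : V} (h : Relation.ReflTransGen Adj b₀ v) (hv : f b₀ < f v) : ∃ u, Adj v u ∧ f u < f v := by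
  obtain ⟨u, h1, h2, -⟩ := (hp.aux hs hv (hp.within hs hf hb h)).2 rfl
  exact ⟨u, h1, h2⟩

theorem exists_walk_of_within {P : V → Prop} {u v : V}
    (h : Relation.ReflTransGen (Within Adj P) u v) : ∃ n, Walk Adj P n u v := by
  induction h with
  | refl => exact ⟨0, .nil _⟩
  | tail _ h2 ih =>
    obtain ⟨n, hn⟩ := ih
    exact ⟨n + 1, hn.append (.single h2.2.1 h2.1)⟩

/-- The set of minimal vertices, if finite, has bounded diameter. -/
theorem HasPeaks.exists_diam (hp : HasPeaks Adj f N) (hs : ∀ u v, Adj u v → Adj v u)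
    (hf : WellFounded fun u v => f u < f v) (hb : ∀ v, f b₀ ≤ f v)
    (h : ∀ v, Relation.ReflTransGen Adj b₀ v) (hfin : {v | f v ≤ f b₀}.Finite) :
    ∃ D, ∀ v, f v ≤ f b₀ → ∃ n ≤ D, Walk Adj (f · ≤ f b₀) n b₀ v := by
  have : ∀ v, ∃ n, f v ≤ f b₀ → Walk Adj (f · ≤ f b₀) n b₀ v := fun v => by
    by_cases hv : f v ≤ f b₀
    · obtain ⟨n, hn⟩ := exists_walk_of_within (hp.within hs hf hb (h v))
      exact ⟨n, fun _ => hn.mono fun x hx => hx.trans hv⟩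
    · exact ⟨0, fun h => absurd h hv⟩
  choose k hk using this
  obtain ⟨D, hD⟩ := (hfin.image k).bddAbove
  exact ⟨D, fun v hv => ⟨k v, hD ⟨v, hv, rfl⟩, hk v hv⟩⟩

/-- `Hol Adj P η n u v h` says that `h` is the product of `η` along some walk of length `n`
from `u` to `v` whose vertices satisfy `P`. -/
inductive Hol {K : Type} [Group K] (Adj : V → V → Prop) (P : V → Prop) (η : V → V → K) :
    ℕ → V → V → K → Prop
  | nil (v : V) : Hol Adj P η 0 v v 1
  | cons {n : ℕ} {u v w : V} {h : K} : P u → P v → Adj u v → Hol Adj P η n v w h →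
      Hol Adj P η (n + 1) u w (η u v * h)

section Cocycle

variable {K : Type} [Group K] {P Q Q' : V → Prop} {η : V → V → K} {F : V → K}

theorem Hol.append {n k : ℕ} {u v w : V} {g h : K} (h1 : Hol Adj P η n u v g)
    (h2 : Hol Adj P η k v w h) : Hol Adj P η (n + k) u w (g * h) := by
  induction h1 with
  | nil => simpa using h2
  | cons a b c _ ih => rw [Nat.add_right_comm, mul_assoc]; exact cons a b c (ih h2)

theorem Hol.single {u v : V} (hu : P u) (hv : P v) (h : Adj u v) : Hol Adj P η 1 u v (η u v) := by
  simpa using Hol.cons hu hv h (Hol.nil (η := η) v)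

theorem Hol.reverse (hs : ∀ u v, Adj u v → Adj v u)
    (hη : ∀ u v, P u → P v → Adj u v → η v u = (η u v)⁻¹) {n : ℕ} {u v : V} {h : K}
    (hw : Hol Adj P η n u v h) : Hol Adj P η n v u h⁻¹ := by
  induction hw with
  | nil => simpa using Hol.nil _
  | cons a b c _ ih =>
    rw [mul_inv_rev, ← hη _ _ a b c]
    exact ih.append (.single b a (hs _ _ c))

theorem Walk.exists_hol {n : ℕ} {u v : V} (h : Walk Adj Q n u v) (hQ : ∀ x, Q x → Q' x)
    (hP : ∀ x, Q' x → P x) (hv : Q' v) (η : V → V → K) :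
    ∃ g, Hol Adj P η n u v g ∧ ∀ F : V → K,
      (∀ x y, Q x → Q' y → Adj x y → F y = F x * η x y) → F v = F u * g := by
  induction h with
  | nil => exact ⟨1, .nil _, by simp⟩
  | @cons n u x w h1 h2 h3 ih =>
    obtain ⟨g, hg, e⟩ := ih hv
    have hx : Q' x := by
      cases h3 with
      | nil => exact hv
      | cons h _ _ => exact hQ _ h
    exact ⟨_, .cons (hP _ (hQ _ h1)) (hP _ hx) h2 hg, fun F hF => by
      rw [e F hF, hF u x h1 hx h2, mul_assoc]⟩

/-- A cocycle with trivial holonomy along short closed walks is a coboundary. -/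
theorem exists_potential {D : ℕ} (hp : HasPeaks Adj f N) (hs : ∀ u v, Adj u v → Adj v u)
    (hf : WellFounded fun u v => f u < f v) (hP : ∀ u v, P v → f u ≤ f v → P u)
    (hPb : P b₀) (hlow : ∀ v, f b₀ < f v → ∃ u, Adj v u ∧ f u < f v)
    (hdiam : ∀ v, f v ≤ f b₀ → ∃ n ≤ D, Walk Adj (f · ≤ f b₀) n b₀ v)
    (h1 : ∀ v n h, n ≤ N + 2 * D + 2 → Hol Adj P η n v v h → h = 1) :
    ∃ F : V → K, ∀ u v, P u → P v → Adj u v → F v = F u * η u v := by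
  classical
  have hη : ∀ u v, P u → P v → Adj u v → η v u = (η u v)⁻¹ := fun u v hu hv h =>
    eq_inv_of_mul_eq_one_right (h1 u 2 _ (by omega)
      ((Hol.single hu hv h).append (Hol.single hv hu (hs _ _ h))))
  have hbase : ∀ v, ∃ h : K, f v ≤ f b₀ → ∃ n ≤ D, Hol Adj P η n b₀ v h := fun v => by
    by_cases hv : f v ≤ f b₀
    · obtain ⟨n, hn, w⟩ := hdiam v hv
      obtain ⟨g, hg, -⟩ := w.exists_hol (P := P) (Q' := (f · ≤ f b₀))
        (fun _ => id) (fun x hx => hP x b₀ hPb hx) hv η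
      exact ⟨g, fun _ => ⟨n, hn, hg⟩⟩
    · exact ⟨1, fun h => absurd h hv⟩
  choose base hbase using hbase
  choose low hlow1 hlow2 using hlow
  let F : V → K := hf.fix fun v rec =>
    if h : f b₀ < f v then rec (low v h) (hlow2 v h) * η (low v h) v else base v
  have hFlow : ∀ v (h : f b₀ < f v), F v = F (low v h) * η (low v h) v := fun v h => by
    rw [show F v = _ from hf.fix_eq _ v, dif_pos h]
  have hFbase : ∀ v, f v ≤ f b₀ → F v = base v := fun v h => by
    rw [show F v = _ from hf.fix_eq _ v, dif_neg h.not_gt]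
  have hflip : ∀ u v, P u → P v → Adj u v → F u = F v * η v u → F v = F u * η u v :=
    fun u v hu hv h e => by rw [e, hη u v hu hv h, inv_mul_cancel_right]
  let T : V → Prop := fun φ => P φ → ∀ v, Adj φ v → f v ≤ f φ → F v = F φ * η φ v
  have caseA : ∀ φ, P φ → (∀ x, f x < f φ → T x) → ∀ v, Adj φ v → f v < f φ →
      F v = F φ * η φ v := by
    intro φ hφ ih v hv hlt
    have hPlt : ∀ x, f x < f φ → P x := fun x hx => hP x φ hφ hx.le
    by_cases hbot : f b₀ < f φ
    · set u := low φ hbot with hu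
      have hau : Adj φ u := hlow1 φ hbot
      have hlu : f u < f φ := hlow2 φ hbot
      obtain ⟨n, hn, w⟩ := hp φ u v hau hv hlu hlt.le
      obtain ⟨g, hg, hF⟩ := w.exists_hol (P := P) (Q' := (f · < f φ)) (fun _ => id) hPlt hlt η
      have e1 : F v = F u * g := by
        refine hF F fun x y hx hy hxy => ?_
        rcases le_total (f y) (f x) with h | h
        · exact ih x hx (hPlt x hx) y hxy h
        · exact hflip x y (hPlt x hx) (hPlt y hy) hxy (ih y hy (hPlt y hy) x (hs _ _ hxy) h)
      have e2 := h1 φ (1 + n + 1) _ (by omega) (((Hol.single hφ (hPlt u hlu) hau).append hg).append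
        (Hol.single (hPlt v hlt) hφ (hs _ _ hv)))
      rw [hη φ v hφ (hPlt v hlt) hv, mul_inv_eq_one] at e2
      rw [e1, hFlow φ hbot, ← hu, hη φ u hφ (hPlt u hlu) hau, mul_assoc, ← e2,
        inv_mul_cancel_left]
    · have h2 := not_lt.1 hbot
      obtain ⟨n, hn, hw⟩ := hbase φ h2
      obtain ⟨k, hk, hw'⟩ := hbase v (hlt.le.trans h2)
      have e2 := h1 b₀ (n + 1 + k) _ (by omega)
        ((hw.append (.single hφ (hPlt v hlt) hv)).append (hw'.reverse hs hη))
      rw [hFbase φ h2, hFbase v (hlt.le.trans h2)]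
      exact (mul_inv_eq_one.1 e2).symm
  have hT : ∀ φ, T φ := by
    intro φ
    induction φ using hf.induction with
    | h φ ih =>
      intro hφ v hv hle
      rcases hle.lt_or_eq with hlt | heq
      · exact caseA φ hφ ih v hv hlt
      have hPle : ∀ x, f x ≤ f φ → P x := fun x hx => hP x φ hφ hx
      by_cases hbot : f b₀ < f φ
      · set u := low φ hbot with hu
        have hau : Adj φ u := hlow1 φ hbot
        have hlu : f u < f φ := hlow2 φ hbot
        obtain ⟨n, hn, w⟩ := hp φ u v hau hv hlu hle
        obtain ⟨g, hg, hF⟩ := w.exists_hol (P := P) (Q' := (f · ≤ f φ)) (fun _ => le_of_lt)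
          hPle hle η
        have e1 : F v = F u * g := by
          refine hF F fun x y hx hy hxy => ?_
          rcases le_total (f y) (f x) with h | h
          · exact ih x hx (hPle x hx.le) y hxy h
          · refine hflip x y (hPle x hx.le) (hPle y hy) hxy ?_
            rcases hy.lt_or_eq with hy' | hy'
            · exact ih y hy' (hPle y hy) x (hs _ _ hxy) h
            · exact caseA y (hPle y hy) (fun z hz => ih z (hy' ▸ hz)) x (hs _ _ hxy) (hy' ▸ hx)
        have e2 := h1 φ (1 + n + 1) _ (by omega)
          (((Hol.single hφ (hPle u hlu.le) hau).append hg).append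
            (Hol.single (hPle v hle) hφ (hs _ _ hv)))
        rw [hη φ v hφ (hPle v hle) hv, mul_inv_eq_one] at e2
        rw [e1, hFlow φ hbot, ← hu, hη φ u hφ (hPle u hlu.le) hau, mul_assoc, ← e2,
          inv_mul_cancel_left]
      · have h2 := not_lt.1 hbot
        obtain ⟨n, hn, hw⟩ := hbase φ h2
        obtain ⟨k, hk, hw'⟩ := hbase v (hle.trans h2)
        have e2 := h1 b₀ (n + 1 + k) _ (by omega)
          ((hw.append (.single hφ (hPle v hle) hv)).append (hw'.reverse hs hη))
        rw [hFbase φ h2, hFbase v (hle.trans h2)]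
        exact (mul_inv_eq_one.1 e2).symm
  refine ⟨F, fun u v hu hv h => ?_⟩
  rcases le_total (f v) (f u) with h' | h'
  · exact hT u hu v h h'
  · exact hflip u v hu hv h (hT v hv u (hs _ _ h) h')

end Cocycle

end Morse

end Whitehead

namespace Whitehead

/-! ### A criterion for finite presentability -/

section Criterion

variable {V V' K K' : Type} [Group K] [Group K'] {Adj : V → V → Prop} {P : V → Prop}
  {η : V → V → K}

theorem Hol.of_map (f : K →* K') {n : ℕ} {u v : V} {h : K'}
    (hw : Hol Adj P (fun u v => f (η u v)) n u v h) : ∃ g, Hol Adj P η n u v g ∧ f g = h := by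
  induction hw with
  | nil => exact ⟨1, .nil _, map_one f⟩
  | cons a b c _ ih =>
    obtain ⟨g, hg, rfl⟩ := ih
    exact ⟨_, .cons a b c hg, map_mul f _ _⟩

theorem Hol.translate (t : V → V) (hP : ∀ v, P v → P (t v)) (hA : ∀ u v, Adj u v → Adj (t u) (t v))
    (hη : ∀ u v, P u → P v → η (t u) (t v) = η u v) {n : ℕ} {u v : V} {h : K}
    (hw : Hol Adj P η n u v h) : Hol Adj P η n (t u) (t v) h := by
  induction hw with
  | nil => exact .nil _
  | cons a b c _ ih =>
    rw [← hη _ _ a b]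
    exact .cons (hP _ a) (hP _ b) (hA _ _ c) ih

theorem Hol.apply_eq (f : K →* K') {c : V → K'}
    (hc : ∀ u v, P u → P v → Adj u v → c v = c u * f (η u v)) {n : ℕ} {u v : V} {h : K}
    (hw : Hol Adj P η n u v h) : c v = c u * f h := by
  induction hw with
  | nil => simp
  | cons a b h1 _ ih => rw [ih, hc _ _ a b h1, map_mul, mul_assoc]

theorem Hol.finite (hA : ∀ u, {v | Adj u v}.Finite) (n : ℕ) (u : V) :
    {h | ∃ v, Hol Adj P η n u v h}.Finite := by
  induction n generalizing u with
  | zero =>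
    refine (Set.finite_singleton (1 : K)).subset ?_
    rintro h ⟨v, hv⟩
    cases hv
    rfl
  | succ n ih =>
    refine ((hA u).biUnion fun v _ => (ih v).image (η u v * ·)).subset ?_
    rintro h ⟨w, hw⟩
    cases hw with
    | @cons _ _ v _ h _ _ h3 h4 =>
      exact Set.mem_biUnion h3 ⟨h, ⟨w, h4⟩, rfl⟩

theorem isFinitelyPresented_of_potential {A : Type} [Group A] {E : Set A} (hE : E.Finite)
    (G : Subgroup A) {P : A → Prop} {ρ : A → A} {v₀ : A} (hv₀ : P v₀)
    (hPG : ∀ g ∈ G, ∀ u, P u → P (g * u))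
    (hρ : ∀ u, P u → u * (ρ u)⁻¹ ∈ G) (hρG : ∀ g ∈ G, ∀ u, P u → ρ (g * u) = ρ u)
    (hfin : (ρ '' {u | P u}).Finite)
    (hconn : ∀ u v, P u → P v →
      Relation.ReflTransGen (Within (fun u v => u⁻¹ * v ∈ E) P) u v) {L : ℕ}
    (hpot : ∀ (K : Type) [Group K] (η : A → A → K),
      (∀ v n h, n ≤ L → Hol (fun u v => u⁻¹ * v ∈ E) P η n v v h → h = 1) →
      ∃ F : A → K, ∀ u v, P u → P v → u⁻¹ * v ∈ E → F v = F u * η u v) :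
    Group.IsFinitelyPresented G := by
  classical
  set R := ρ '' {u | P u} with hR
  have hPρ : ∀ u, P u → P (ρ u) := fun u hu => by
    simpa using hPG _ (inv_mem (hρ u hu)) u hu
  have hRP : ∀ t ∈ R, P t := by rintro _ ⟨u, hu, rfl⟩; exact hPρ u hu
  have hρρ : ∀ u, P u → ρ (ρ u) = ρ u := fun u hu => by
    simpa using hρG _ (inv_mem (hρ u hu)) u hu
  have hRρ : ∀ t ∈ R, ρ t = t := by rintro _ ⟨u, hu, rfl⟩; exact hρρ u hu
  have hPρ' : ∀ u v, P u → (P (ρ u * (u⁻¹ * v)) ↔ P v) := fun u v hu => by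
    have e : v = (u * (ρ u)⁻¹) * (ρ u * (u⁻¹ * v)) := by group
    refine ⟨fun h => e ▸ hPG _ (hρ u hu) _ h, fun h => ?_⟩
    rw [show ρ u * (u⁻¹ * v) = (u * (ρ u)⁻¹)⁻¹ * v by group]
    exact hPG _ (inv_mem (hρ u hu)) _ h
  let I : Set (A × A) := {x | x ∈ R ×ˢ E ∧ P (x.1 * x.2)}
  have hI : I.Finite := (hfin.prod hE).subset fun x hx => hx.1
  have : Finite I := hI
  let η₀ : A → A → FreeGroup I := fun u v =>
    if h : (ρ u, u⁻¹ * v) ∈ I then FreeGroup.of ⟨_, h⟩ else 1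
  have hη₀ : ∀ g ∈ G, ∀ u v, P u → η₀ (g * u) (g * v) = η₀ u v := fun g hg u v hu => by
    have h1 : (g * u)⁻¹ * (g * v) = u⁻¹ * v := by group
    simp only [η₀, hρG g hg u hu, h1]
  let Adj : A → A → Prop := fun u v => u⁻¹ * v ∈ E
  have hAdj : ∀ g u v, Adj u v → Adj (g * u) (g * v) := fun g u v h => by
    change (g * u)⁻¹ * (g * v) ∈ E
    rwa [show (g * u)⁻¹ * (g * v) = u⁻¹ * v by group]
  have hAfin : ∀ u, {v | Adj u v}.Finite := fun u => by
    refine (hE.image (u * ·)).subset fun v hv => ⟨_, hv, by simp⟩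
  let rels : Set (FreeGroup I) := {h | ∃ t ∈ R, ∃ n ∈ Set.Iic L, Hol Adj P η₀ n t t h}
  have hrels : rels.Finite := by
    have : rels ⊆ ⋃ t ∈ R, ⋃ n ∈ Set.Iic L, {h | ∃ v, Hol Adj P η₀ n t v h} := by
      rintro h ⟨t, ht, n, hn, hh⟩
      exact Set.mem_biUnion ht (Set.mem_biUnion hn ⟨t, hh⟩)
    exact (hfin.biUnion fun t _ => (Set.finite_Iic L).biUnion fun n _ =>
      Hol.finite hAfin n t).subset this
  have : Finite rels := hrels
  let π := PresentedGroup.mk rels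
  obtain ⟨F₀, hF₀⟩ := hpot (PresentedGroup rels) (fun u v => π (η₀ u v)) (by
    intro v n h hn hw
    obtain ⟨g, hg, rfl⟩ := hw.of_map π
    by_cases hv : P v
    · have hc := inv_mem (hρ v hv)
      have hg' := hg.translate ((v * (ρ v)⁻¹)⁻¹ * ·) (hPG _ hc) (hAdj _)
        (fun u v hu _ => hη₀ _ hc u v hu)
      rw [show (v * (ρ v)⁻¹)⁻¹ * v = ρ v by group] at hg'
      exact PresentedGroup.one_of_mem ⟨ρ v, ⟨v, hv, rfl⟩, n, hn, hg'⟩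
    · cases hg with
      | nil => simp
      | cons h => exact absurd h hv)
  let r₀ := ρ v₀
  have hr₀R : r₀ ∈ R := ⟨v₀, hv₀, rfl⟩
  have hr₀ : P r₀ := hRP _ hr₀R
  let F : A → PresentedGroup rels := fun v => (F₀ r₀)⁻¹ * F₀ v
  have hF : ∀ u v, P u → P v → Adj u v → F v = F u * π (η₀ u v) := fun u v hu hv h => by
    simp only [F, hF₀ u v hu hv h, mul_assoc]
  have hFr₀ : F r₀ = 1 := inv_mul_cancel _
  -- two potentials which agree at the base point agree
  have huniq : ∀ (M : Type) [Group M] (m : A → A → M) (f₁ f₂ : A → M),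
      (∀ u v, P u → P v → Adj u v → f₁ v = f₁ u * m u v) →
      (∀ u v, P u → P v → Adj u v → f₂ v = f₂ u * m u v) → f₁ r₀ = f₂ r₀ →
      ∀ v, P v → f₁ v = f₂ v := by
    intro M _ m f₁ f₂ h1 h2 h0 v hv
    have := hconn r₀ v hr₀ hv
    clear hv
    induction this with
    | refl => exact h0
    | tail _ h ih =>
      obtain ⟨h, hu, hv⟩ := h
      rw [h1 _ _ hu hv h, h2 _ _ hu hv h, ih]
  let c : A → G := fun u => if h : P u then ⟨u * (ρ u)⁻¹, hρ u h⟩ else 1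
  have hc : ∀ u, P u → (c u : A) = u * (ρ u)⁻¹ := fun u hu => by simp only [c, dif_pos hu]
  have hcR : ∀ t ∈ R, c t = 1 := fun t ht => by
    apply Subtype.ext
    rw [hc t (hRP t ht), hRρ t ht, mul_inv_cancel, Subgroup.coe_one]
  let Φ₀ : FreeGroup I →* G := FreeGroup.lift fun x => c (x.1.1 * x.1.2)
  have hΦη : ∀ u v, P u → P v → Adj u v → c v = c u * Φ₀ (η₀ u v) := fun u v hu hv h => by
    have hmem : (ρ u, u⁻¹ * v) ∈ I := ⟨⟨⟨u, hu, rfl⟩, h⟩, (hPρ' u v hu).2 hv⟩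
    have hg := inv_mem (hρ u hu)
    have e : ρ u * (u⁻¹ * v) = (u * (ρ u)⁻¹)⁻¹ * v := by group
    have e' : Φ₀ (η₀ u v) = c (ρ u * (u⁻¹ * v)) := by
      simp only [η₀, dif_pos hmem, Φ₀, FreeGroup.lift_apply_of]
    apply Subtype.ext
    rw [e', Subgroup.coe_mul, hc v hv, hc u hu, hc _ hmem.2, e, hρG _ hg v hv]
    group
  let Φ₁ : PresentedGroup rels →* G := QuotientGroup.lift _ Φ₀ (by
    refine Subgroup.normalClosure_le_normal ?_
    rintro h ⟨t, -, n, -, hw⟩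
    exact left_eq_mul.1 (hw.apply_eq Φ₀ hΦη))
  have hΦ₁ : ∀ x, Φ₁ (π x) = Φ₀ x := fun x => rfl
  have hΦF : ∀ v, P v → Φ₁ (F v) = c v := by
    refine huniq G (fun u v => Φ₀ (η₀ u v)) _ _ (fun u v hu hv h => ?_) hΦη ?_
    · rw [hF u v hu hv h, map_mul, hΦ₁]
    · rw [hFr₀, map_one, hcR r₀ hr₀R]
  let N := Subgroup.normalClosure (F '' R)
  have hN : N.IsFinitelyNormallyGenerated := ⟨F '' R, hfin.image F, rfl⟩
  let Φ : PresentedGroup rels ⧸ N →* G := QuotientGroup.lift N Φ₁ (by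
    refine Subgroup.normalClosure_le_normal ?_
    rintro _ ⟨t, ht, rfl⟩
    exact (hΦF t (hRP t ht)).trans (hcR t ht))
  let F' : A → PresentedGroup rels ⧸ N := fun v => QuotientGroup.mk' N (F v)
  have hF'R : ∀ t ∈ R, F' t = 1 := fun t ht =>
    (QuotientGroup.eq_one_iff _).2 (Subgroup.subset_normalClosure ⟨t, ht, rfl⟩)
  have hF' : ∀ u v, P u → P v → Adj u v →
      F' v = F' u * QuotientGroup.mk' N (π (η₀ u v)) := fun u v hu hv h => by
    simp only [F', hF u v hu hv h, map_mul]
  have hF'mul : ∀ g ∈ G, ∀ v, P v → F' (g * v) = F' (g * r₀) * F' v := by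
    intro g hg
    refine huniq _ (fun u v => QuotientGroup.mk' N (π (η₀ u v))) (fun v => F' (g * v)) _
      (fun u v hu hv h => ?_) (fun u v hu hv h => ?_) ?_
    · rw [hF' _ _ (hPG g hg u hu) (hPG g hg v hv) (hAdj g _ _ h), hη₀ g hg u v hu]
    · rw [hF' u v hu hv h, mul_assoc]
    · rw [hF'R r₀ hr₀R, mul_one]
  let Ψ : G →* PresentedGroup rels ⧸ N := MonoidHom.mk' (fun g => F' (g * r₀)) fun g h => by
    rw [Subgroup.coe_mul, mul_assoc, hF'mul g g.2 _ (hPG h h.2 _ hr₀)]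
  have hinj : Function.LeftInverse Φ Ψ := fun g => by
    have h1 : Φ (Ψ g) = Φ₁ (F (g * r₀)) := rfl
    have hP := hPG g g.2 _ hr₀
    apply Subtype.ext
    rw [h1, hΦF _ hP, hc _ hP, hρG g g.2 _ hr₀, hRρ r₀ hr₀R]
    group
  have hsurj : Function.Surjective Ψ := by
    have : Ψ.comp Φ = MonoidHom.id _ := by
      refine QuotientGroup.monoidHom_ext _ (PresentedGroup.ext ?_)
      rintro ⟨⟨t, e⟩, ⟨ht, he⟩, hP⟩
      change t ∈ R at ht
      change P (t * e) at hP
      have hmem : (t, e) ∈ I := ⟨⟨ht, he⟩, hP⟩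
      have h1 : η₀ t (t * e) = FreeGroup.of ⟨(t, e), hmem⟩ := by
        simp only [η₀, hRρ t ht, inv_mul_cancel_left, dif_pos hmem]
      have h2 : Φ₀ (FreeGroup.of ⟨(t, e), hmem⟩) = c (t * e) := by
        simp only [Φ₀, FreeGroup.lift_apply_of]
      have h3 := hF' t (t * e) (hRP t ht) hP (by simpa [Adj] using he)
      have h4 := hF'mul _ (c (t * e)).2 _ (hPρ _ hP)
      rw [hc _ hP, inv_mul_cancel_right, hF'R _ ⟨_, hP, rfl⟩, mul_one, ← hc _ hP] at h4
      rw [hF'R t ht, one_mul, h1, h4, ← h2] at h3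
      exact h3
    exact fun x => ⟨Φ x, DFunLike.congr_fun this x⟩
  have := Group.IsFinitelyPresented.quotient N hN
  exact Group.IsFinitelyPresented.equiv (MulEquiv.ofBijective Ψ ⟨hinj.injective, hsurj⟩).symm

end Criterion

end Whitehead

namespace Whitehead

open Pointwise

/-! ### Counting jumps -/

section Jumps

variable {F : Type} [Group F]

/-- The number of jumps of `S` in the direction `w`. -/
noncomputable def aN (w : F) (S : Set F) : ℕ := (jump w S).ncard

theorem aN_smul (w g : F) (S : Set F) : aN w (g • S) = aN w S := by
  rw [aN, jump_smul, Set.ncard_smul_set, aN]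

theorem aN_compl (w : F) (S : Set F) : aN w Sᶜ = aN w S := by
  rw [aN, jump_compl, aN]

theorem aN_aut (φ : MulAut F) (w : F) (S : Set F) : aN w (φ • S) = aN (φ⁻¹ w) S := by
  rw [aN, jump_aut', Set.ncard_smul_set, aN]

theorem jump_submod_union (w : F) (A B : Set F) :
    jump w (A ∩ B) ∪ jump w (A ∪ B) ⊆ jump w A ∪ jump w B := by
  intro g
  simp only [mem_jump, Set.mem_union, Set.mem_inter_iff]
  tauto

theorem jump_submod_inter (w : F) (A B : Set F) :
    jump w (A ∩ B) ∩ jump w (A ∪ B) ⊆ jump w A ∩ jump w B := by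
  intro g
  simp only [mem_jump, Set.mem_union, Set.mem_inter_iff]
  tauto

theorem aN_submod (w : F) {A B : Set F} (hA : AI A) (hB : AI B) :
    aN w (A ∩ B) + aN w (A ∪ B) ≤ aN w A + aN w B := by
  unfold aN
  have hA' := hA w
  have hB' := hB w
  rw [← Set.ncard_union_add_ncard_inter _ _ (hA.inter hB w) (hA.union hB w),
    ← Set.ncard_union_add_ncard_inter _ _ hA' hB']
  exact add_le_add (Set.ncard_le_ncard (jump_submod_union w A B) (hA'.union hB'))
    (Set.ncard_le_ncard (jump_submod_inter w A B) (hA'.inter_of_left _))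

theorem aN_submod_strict {A B : Set F} (hA : AI A) (hB : AI B) {p q : F} (hp : p ∈ B \ A)
    (hq : q ∈ A \ B) :
    aN (p⁻¹ * q) (A ∩ B) + aN (p⁻¹ * q) (A ∪ B) < aN (p⁻¹ * q) A + aN (p⁻¹ * q) B := by
  unfold aN
  have hA' := hA (p⁻¹ * q)
  have hB' := hB (p⁻¹ * q)
  rw [← Set.ncard_union_add_ncard_inter _ _ (hA.inter hB _) (hA.union hB _),
    ← Set.ncard_union_add_ncard_inter _ _ hA' hB']
  refine add_lt_add_of_lt_of_le (Set.ncard_lt_ncard ⟨jump_submod_union _ A B, fun h => ?_⟩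
    (hA'.union hB')) (Set.ncard_le_ncard (jump_submod_inter _ A B) (hA'.inter_of_left _))
  have h1 : p ∈ jump (p⁻¹ * q) A := by
    rw [mem_jump, mul_inv_cancel_left]; exact fun h => hp.2 (h.2 hq.1)
  have h2 := h (Or.inl h1)
  simp only [Set.mem_union, mem_jump, mul_inv_cancel_left, Set.mem_inter_iff] at h2
  have := hp.1; have := hp.2; have := hq.1; have := hq.2
  tauto

theorem aN_mul_le (v w : F) {S : Set F} (hS : AI S) : aN (v * w) S ≤ aN v S + aN w S := by
  have h : ((· * v) ⁻¹' jump w S).Finite := (hS w).preimage (mul_left_injective v).injOn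
  refine (Set.ncard_le_ncard (jump_mul_subset v w S) ((hS v).union h)).trans
    ((Set.ncard_union_le _ _).trans (add_le_add le_rfl ?_))
  exact Set.ncard_le_ncard_of_injOn (· * v) (fun g hg => hg) (mul_left_injective v).injOn (hS w)

theorem aN_inv (w : F) (S : Set F) : aN w⁻¹ S = aN w S := by
  unfold aN
  refine Set.ncard_congr (fun g _ => g * w⁻¹) ?_ (fun a b _ _ h => mul_left_injective _ h) ?_
  · intro g
    simp only [mem_jump, inv_mul_cancel_right]
    tauto
  · intro g hg
    refine ⟨g * w, ?_, by simp⟩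
    simp only [mem_jump, mul_inv_cancel_right] at hg ⊢
    tauto

theorem aN_conj_le (w h : F) {S : Set F} (hS : AI S) :
    aN (h * w * h⁻¹) S ≤ aN w S + 2 * aN h S := by
  have h1 := aN_mul_le (h * w) h⁻¹ hS
  have h2 := aN_mul_le h w hS
  rw [aN_inv] at h1
  omega

/-- The cost counting the jumps in the directions of a finite family. -/
noncomputable def jumpCost {ι : Type} (s : Finset ι) (w : ι → F) : Cost F ℝ where
  N S := ((∑ i ∈ s, aN (w i) S : ℕ) : ℝ)
  smul g S := by simp only [aN_smul]
  compl S := by simp only [aN_compl]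
  submod A B hA hB := by
    rw [← Nat.cast_add, ← Nat.cast_add, Nat.cast_le, ← Finset.sum_add_distrib,
      ← Finset.sum_add_distrib]
    exact Finset.sum_le_sum fun i _ => aN_submod _ hA hB

theorem jumpCost_N {ι : Type} (s : Finset ι) (w : ι → F) (S : Set F) :
    (jumpCost s w).N S = ((∑ i ∈ s, aN (w i) S : ℕ) : ℝ) := rfl

end Jumps

section JumpsFree

variable {α : Type} [DecidableEq α]

theorem aN_lt_H (z u : α × Bool) : aN (lt z) (H u) = if z.1 = u.1 then 1 else 0 := by
  unfold aN
  split_ifs with h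
  · by_cases hz : z = u
    · subst hz
      refine Set.ncard_eq_one.2 ⟨1, Set.eq_singleton_iff_unique_mem.2 ⟨by simp [mem_jump], ?_⟩⟩
      intro g hg
      by_contra hc
      exact hg (mem_H_mul_lt (fun h => hc h.2) fun h => bar_ne z h.1.symm)
    · have hz : z = bar u := by
        obtain ⟨i, b⟩ := z
        obtain ⟨j, c⟩ := u
        cases b <;> cases c <;> simp_all [bar]
      subst hz
      refine Set.ncard_eq_one.2 ⟨lt u, Set.eq_singleton_iff_unique_mem.2
        ⟨by simp [mem_jump], ?_⟩⟩
      intro g hg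
      by_contra hc
      exact hg (mem_H_mul_lt (fun h => bar_ne u h.1) fun h => hc h.2)
  · rw [Set.ncard_eq_zero (AI_H u _), Set.eq_empty_iff_forall_notMem]
    intro g hg
    exact hg (mem_H_mul_lt (fun hc => h (by rw [hc.1])) fun hc => h (by rw [hc.1]; rfl))

theorem aN_of_H (i : α) (u : α × Bool) : aN (FreeGroup.of i) (H u) = if i = u.1 then 1 else 0 :=
  aN_lt_H (i, true) u

variable [Fintype α]

/-- The separation of `g` and `g * w` by half-spaces bounds the length of `w`. -/
theorem norm_lt_sum_aN {w : FreeGroup α} (hw : w ≠ 1) : w.norm + 1 ≤ ∑ u, aN w (H u) := by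
  have hmk : FreeGroup.mk w.toWord = w := FreeGroup.mk_toWord
  let p : ℕ → FreeGroup α := fun i => FreeGroup.mk (w.toWord.take i)
  have hred : ∀ i, FreeGroup.IsReduced (w.toWord.take i ++ w.toWord.drop i) := fun i => by
    rw [List.take_append_drop]; exact FreeGroup.isReduced_toWord
  have hred1 : ∀ i, FreeGroup.IsReduced (w.toWord.take i) := fun i =>
    (List.isChain_append.1 (hred i)).1
  have hred2 : ∀ i, FreeGroup.IsReduced (w.toWord.drop i) := fun i =>
    (List.isChain_append.1 (hred i)).2.1
  have hpw : ∀ i, (p i)⁻¹ * w = FreeGroup.mk (w.toWord.drop i) := fun i => by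
    rw [inv_mul_eq_iff_eq_mul, FreeGroup.mul_mk, List.take_append_drop, hmk]
  have hinj : Set.InjOn (fun i => (p i)⁻¹) (Finset.range (w.norm + 1) : Set ℕ) := by
    intro i hi j hj hij
    have h1 := congrArg FreeGroup.toWord (inv_injective hij)
    simp only [p, toWord_mk_of_isReduced (hred1 _)] at h1
    have h2 := congrArg List.length h1
    simp only [FreeGroup.norm, Finset.coe_range, Set.mem_Iio] at hi hj
    simp only [List.length_take] at h2
    omega
  have hsub : ∀ i, (p i)⁻¹ ∈ ⋃ u ∈ (Finset.univ : Finset (α × Bool)), jump w (H u) := by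
    intro i
    have hne : hd (p i)⁻¹ ≠ hd ((p i)⁻¹ * w) := by
      intro h
      have h1 : hd (p i)⁻¹ = ((w.toWord.take i).getLast?).map bar := by
        rw [hd, FreeGroup.toWord_inv, toWord_mk_of_isReduced (hred1 i), FreeGroup.invRev,
          List.head?_reverse, List.getLast?_map]
        rfl
      rw [hpw, hd_mk (hred2 i)] at h
      rcases hd' : (w.toWord.drop i).head? with _ | u
      · have e1 : (p i)⁻¹ = 1 := by rw [← hd_eq_none, h, hd']
        have e2 : w = 1 := by
          have := hpw i
          rw [e1, one_mul, List.head?_eq_none_iff.1 hd'] at this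
          exact this
        exact hw e2
      · rw [h1, hd'] at h
        obtain ⟨v, hv, hvu⟩ := Option.map_eq_some_iff.1 h
        have := (List.isChain_append.1 (hred i)).2.2 v hv u hd'
        rw [← hvu] at this
        simp [bar] at this
    by_contra hc
    simp only [Finset.mem_univ, Set.iUnion_true, Set.mem_iUnion, mem_jump, not_exists, not_not,
      mem_H] at hc
    apply hne
    rcases h1 : hd (p i)⁻¹ with _ | u
    · rcases h2 : hd ((p i)⁻¹ * w) with _ | u
      · rfl
      · rw [(hc u).2 h2] at h1; cases h1
    · exact ((hc u).1 h1).symm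
  have hfin : (⋃ u ∈ (Finset.univ : Finset (α × Bool)), jump w (H u)).Finite :=
    Set.Finite.biUnion (Finset.finite_toSet _) fun u _ => AI_H u w
  calc w.norm + 1 = (Finset.range (w.norm + 1) : Set ℕ).ncard := by
        rw [Set.ncard_coe_finset, Finset.card_range]
    _ = ((fun i => (p i)⁻¹) '' (Finset.range (w.norm + 1) : Set ℕ)).ncard :=
        hinj.ncard_image.symm
    _ ≤ (⋃ u ∈ (Finset.univ : Finset (α × Bool)), jump w (H u)).ncard :=
        Set.ncard_le_ncard (by rintro _ ⟨i, -, rfl⟩; exact hsub i) hfin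
    _ ≤ _ := Finset.set_ncard_biUnion_le _ _

theorem norm_le_sum_aN (w : FreeGroup α) : w.norm ≤ ∑ u, aN w (H u) := by
  by_cases hw : w = 1
  · simp [hw]
  · have := norm_lt_sum_aN hw
    omega

theorem finite_norm_le (r : ℕ) : {w : FreeGroup α | w.norm ≤ r}.Finite :=
  Set.Finite.of_finite_image ((List.finite_length_le (α × Bool) r).subset
    (by rintro _ ⟨w, hw, rfl⟩; exact hw)) FreeGroup.toWord_injective.injOn

/-- The cost of a free group automorphism measured by the basis. -/
noncomputable def letterCost (α : Type) [Fintype α] [DecidableEq α] : Cost (FreeGroup α) ℝ :=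
  jumpCost Finset.univ FreeGroup.of

theorem letterCost_val (φ : MulAut (FreeGroup α)) :
    (letterCost α).val φ =
      ((∑ i : α, ∑ u : α × Bool, aN (φ⁻¹ (FreeGroup.of i)) (H u) : ℕ) : ℝ) := by
  rw [Finset.sum_comm]
  simp only [Cost.val, letterCost, jumpCost_N, aN_aut, Nat.cast_sum]

theorem finite_letterCost_le (x : ℝ) : {φ | (letterCost α).val φ ≤ x}.Finite := by
  obtain ⟨n, hn⟩ := exists_nat_ge x
  refine Set.Finite.of_finite_image (f := fun φ (i : α) => φ⁻¹ (FreeGroup.of i))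
    ((Set.Finite.pi' fun _ => finite_norm_le n).subset ?_) ?_
  · rintro _ ⟨φ, hφ, rfl⟩ i
    rw [Set.mem_ofPred_eq, letterCost_val] at hφ
    have h : ∑ i : α, ∑ u : α × Bool, aN (φ⁻¹ (FreeGroup.of i)) (H u) ≤ n := by
      exact_mod_cast hφ.trans hn
    exact (norm_le_sum_aN _).trans ((Finset.single_le_sum
      (f := fun i : α => ∑ u : α × Bool, aN (φ⁻¹ (FreeGroup.of i)) (H u))
      (fun _ _ => Nat.zero_le _) (Finset.mem_univ i)).trans h)
  · intro φ _ ψ _ h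
    refine inv_injective (mulAut_ext_letters fun u => ?_)
    have h1 := congrFun h u.1
    obtain ⟨i, b⟩ := u
    cases b
    · rw [lt_false, map_inv, map_inv]; exact congrArg _ h1
    · exact h1

end JumpsFree

end Whitehead

namespace Whitehead

open Pointwise

/-! ### Recognizing half-spaces -/

section HS

variable {α : Type}

theorem exists_aN_ne_zero {R : Set (FreeGroup α)} (hR : AI R) (h0 : R ≠ ∅) (h1 : R ≠ Set.univ) :
    ∃ i, aN (FreeGroup.of i) R ≠ 0 := by
  by_contra! hc
  have hl : ∀ u : α × Bool, ∀ g, g ∈ R ↔ g * lt u ∈ R := by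
    have hz : ∀ i g, g ∈ R ↔ g * FreeGroup.of i ∈ R := fun i g => by
      have := (Set.ncard_eq_zero (hR _)).1 (hc i)
      by_contra h
      exact (Set.eq_empty_iff_forall_notMem.1 this) g h
    rintro ⟨i, b⟩ g
    cases b
    · rw [lt_false, hz i (g * (FreeGroup.of i)⁻¹), inv_mul_cancel_right]
    · exact hz i g
  have hall : ∀ w g, g ∈ R ↔ g * w ∈ R := by
    intro w
    induction w using letter_induction with
    | one => simp
    | mul w u ih => intro g; rw [ih g, hl u, mul_assoc]
  obtain ⟨x, hx⟩ := Set.nonempty_iff_ne_empty.2 h0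
  refine h1 (Set.eq_univ_of_forall fun y => ?_)
  rw [← mul_inv_cancel_left x y, ← hall]
  exact hx

variable [DecidableEq α]

/-- Translates of half-spaces. -/
def HS (R : Set (FreeGroup α)) : Prop := ∃ (g : FreeGroup α) (u : α × Bool), R = g • H u

theorem HS.smul {R : Set (FreeGroup α)} (h : HS R) (g : FreeGroup α) : HS (g • R) := by
  obtain ⟨k, u, rfl⟩ := h
  exact ⟨g * k, u, (mul_smul _ _ _).symm⟩

theorem compl_H (u : α × Bool) : (H u)ᶜ = lt u • H (bar u) := by
  rw [H_bar, smul_inv_smul]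

theorem HS.compl {R : Set (FreeGroup α)} (h : HS R) : HS Rᶜ := by
  obtain ⟨k, u, rfl⟩ := h
  exact ⟨k * lt u, bar u, by rw [← Set.smul_set_compl, compl_H, mul_smul]⟩

theorem HS.AI {R : Set (FreeGroup α)} (h : HS R) : AI R := by
  obtain ⟨k, u, rfl⟩ := h
  exact (AI_H u).smul k

theorem HS.of_smul {R : Set (FreeGroup α)} {g : FreeGroup α} (h : HS (g • R)) : HS R := by
  simpa using h.smul g⁻¹

theorem HS.of_compl {R : Set (FreeGroup α)} (h : HS Rᶜ) : HS R := by simpa using h.compl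

theorem HS.exists_aN {R : Set (FreeGroup α)} (h : HS R) :
    ∃ i, ∀ j, aN (FreeGroup.of j) R = if j = i then 1 else 0 := by
  obtain ⟨k, u, rfl⟩ := h
  exact ⟨u.1, fun j => by rw [aN_smul, aN_of_H]⟩

/-- Half-spaces of the same type agree up to translation and complement. -/
theorem HS.eq_or {R T : Set (FreeGroup α)} (hR : HS R) (hT : HS T) {i : α}
    (hi : aN (FreeGroup.of i) R ≠ 0) (hi' : aN (FreeGroup.of i) T ≠ 0) :
    ∃ g : FreeGroup α, R = g • T ∨ R = g • Tᶜ := by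
  obtain ⟨k, u, rfl⟩ := hR
  obtain ⟨l, v, rfl⟩ := hT
  rw [aN_smul, aN_of_H] at hi hi'
  have h1 : i = u.1 := by by_contra h; exact hi (if_neg h)
  have h2 : i = v.1 := by by_contra h; exact hi' (if_neg h)
  by_cases h : u = v
  · subst h
    exact ⟨k * l⁻¹, Or.inl (by rw [mul_smul, inv_smul_smul])⟩
  · have h : v = bar u := by
      obtain ⟨i, b⟩ := u
      obtain ⟨j, c⟩ := v
      cases b <;> cases c <;> simp_all [bar]
    subst h
    refine ⟨k * lt u * l⁻¹, Or.inr ?_⟩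
    rw [← Set.smul_set_compl, compl_H, bar_bar, lt_bar, mul_smul, inv_smul_smul, mul_smul,
      smul_inv_smul]

theorem eq_H_of_jump {R : Set (FreeGroup α)} {i : α} (h1 : (1 : FreeGroup α) ∉ R)
    (hi : jump (FreeGroup.of i) R = {1}) (hj : ∀ j, j ≠ i → jump (FreeGroup.of j) R = ∅) :
    R = H (i, true) := by
  have hm : ∀ j g, ¬(j = i ∧ g = 1) → (g ∈ R ↔ g * FreeGroup.of j ∈ R) := by
    intro j g h
    by_contra hc
    have hc : g ∈ jump (FreeGroup.of j) R := hc
    by_cases hji : j = i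
    · subst hji
      rw [hi] at hc
      exact h ⟨rfl, hc⟩
    · rw [hj j hji] at hc
      exact hc
  have hl : lt (i, true) ∈ R := by
    have : (1 : FreeGroup α) ∈ jump (FreeGroup.of i) R := by rw [hi]; rfl
    rw [mem_jump, one_mul] at this
    rw [lt_true]
    tauto
  refine eq_H h1 hl ?_
  rintro ⟨j, b⟩ g ha hb
  cases b
  · rw [lt_false, hm j (g * (FreeGroup.of j)⁻¹), inv_mul_cancel_right]
    rintro ⟨rfl, h⟩
    exact hb ⟨rfl, by rw [lt_true]; exact mul_inv_eq_one.1 h⟩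
  · exact hm j g fun h => ha ⟨by rw [h.1], h.2⟩

theorem HS_of_sum_le [Fintype α] {R : Set (FreeGroup α)} (hR : AI R) (h0 : R ≠ ∅)
    (h1 : R ≠ Set.univ) (hs : ∑ i, aN (FreeGroup.of i) R ≤ 1) : HS R := by
  obtain ⟨i, hi⟩ := exists_aN_ne_zero hR h0 h1
  have hsum := Finset.add_sum_erase Finset.univ (fun i => aN (FreeGroup.of i) R)
    (Finset.mem_univ i)
  have hi1 : aN (FreeGroup.of i) R = 1 := by omega
  have hj : ∀ j, j ≠ i → aN (FreeGroup.of j) R = 0 := fun j hj => by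
    have := Finset.single_le_sum (f := fun i => aN (FreeGroup.of i) R)
      (fun _ _ => Nat.zero_le _) (Finset.mem_erase.2 ⟨hj, Finset.mem_univ j⟩)
    omega
  obtain ⟨g, hg⟩ := Set.ncard_eq_one.1 hi1
  have hi' : jump (FreeGroup.of i) (g⁻¹ • R) = {1} := by
    rw [jump_smul, hg]; simp
  have hj' : ∀ j, j ≠ i → jump (FreeGroup.of j) (g⁻¹ • R) = ∅ := fun j hji => by
    rw [jump_smul, (Set.ncard_eq_zero (hR _)).1 (hj j hji), Set.smul_set_empty]
  apply HS.of_smul (g := g⁻¹)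
  by_cases h : (1 : FreeGroup α) ∈ g⁻¹ • R
  · apply HS.of_compl
    have := eq_H_of_jump (R := (g⁻¹ • R)ᶜ) (not_not.2 h) (by rw [jump_compl, hi'])
      fun j hji => by rw [jump_compl, hj' j hji]
    exact ⟨1, _, this.trans (one_smul _ _).symm⟩
  · exact ⟨1, _, (eq_H_of_jump h hi' hj').trans (one_smul _ _).symm⟩

/-- The cost counting jumps in all directions of length at most `r`. -/
noncomputable def ballCost (α : Type) [Fintype α] [DecidableEq α] (r : ℕ) :
    Cost (FreeGroup α) ℝ :=
  jumpCost (finite_norm_le r).toFinset id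

theorem norm_signedPerm_le {σ : MulAut (FreeGroup α)} (hσ : σ ∈ SignedPerm) (w : FreeGroup α) :
    (σ w).norm ≤ w.norm := by
  obtain ⟨π, hπ⟩ := hσ
  have h : ∀ l : List (α × Bool), σ (FreeGroup.mk l) = FreeGroup.mk (l.map π) := by
    intro l
    induction l with
    | nil => rw [List.map_nil, ← FreeGroup.one_eq_mk, map_one]
    | cons u l ih => rw [← lt_mul_mk, map_mul, hπ, ih, lt_mul_mk, List.map_cons]
  calc (σ w).norm = (σ (FreeGroup.mk w.toWord)).norm := by rw [FreeGroup.mk_toWord]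
    _ ≤ _ := by
      rw [h]
      exact FreeGroup.norm_mk_le.trans (by rw [List.length_map]; rfl)

theorem ballCost_smul [Fintype α] (r : ℕ) {σ : MulAut (FreeGroup α)} (hσ : σ ∈ SignedPerm)
    (R : Set (FreeGroup α)) : (ballCost α r).N (σ • R) = (ballCost α r).N R := by
  simp only [ballCost, jumpCost_N, aN_aut, id, Nat.cast_inj]
  refine Finset.sum_bij' (fun w _ => σ⁻¹ w) (fun w _ => σ w) ?_ ?_ ?_ ?_ ?_
  · intro w hw
    simp only [Set.Finite.mem_toFinset, Set.mem_ofPred_eq] at hw ⊢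
    exact (norm_signedPerm_le (inv_mem hσ) w).trans hw
  · intro w hw
    simp only [Set.Finite.mem_toFinset, Set.mem_ofPred_eq] at hw ⊢
    exact (norm_signedPerm_le hσ w).trans hw
  · exact fun w _ => MulAut.apply_inv_self _ σ w
  · exact fun w _ => MulAut.inv_apply_self _ σ w
  · intro w _; rfl

theorem exists_signedPerm (i j : α) :
    ∃ σ ∈ SignedPerm (α := α), σ • H (i, true) = H (j, true) := by
  have h : ∀ u : α × Bool, FreeGroup.freeGroupCongr (Equiv.swap i j) (lt u) =
      lt ((Equiv.swap i j).prodCongr (Equiv.refl Bool) u) := by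
    rintro ⟨k, b⟩
    cases b <;> simp [lt_false, lt_true]
  refine ⟨FreeGroup.freeGroupCongr (Equiv.swap i j), ⟨_, h⟩, ?_⟩
  rw [smul_H h]
  simp

theorem ballCost_HS [Fintype α] (r : ℕ) {R T : Set (FreeGroup α)} (hR : HS R) (hT : HS T) :
    (ballCost α r).N R = (ballCost α r).N T := by
  have key : ∀ (u v : α × Bool), (ballCost α r).N (H u) = (ballCost α r).N (H v) := by
    have ht : ∀ u : α × Bool, (ballCost α r).N (H u) = (ballCost α r).N (H (u.1, true)) := by
      rintro ⟨i, b⟩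
      cases b
      · exact (ballCost α r).N_H_bar (i, true)
      · rfl
    intro u v
    rw [ht u, ht v]
    obtain ⟨σ, hσ, h⟩ := exists_signedPerm u.1 v.1
    rw [← h, ballCost_smul r hσ]
  obtain ⟨k, u, rfl⟩ := hR
  obtain ⟨l, v, rfl⟩ := hT
  rw [Cost.smul, Cost.smul, key u v]

end HS

end Whitehead

namespace Whitehead

open Pointwise

/-! ### Automorphisms of minimal cost are signed permutations -/

section Parity

variable {α : Type}

theorem smul_ne_empty {φ : MulAut (FreeGroup α)} {R : Set (FreeGroup α)} (h : R ≠ ∅) :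
    φ • R ≠ ∅ := by simpa

theorem smul_ne_univ {φ : MulAut (FreeGroup α)} {R : Set (FreeGroup α)} (h : R ≠ Set.univ) :
    φ • R ≠ Set.univ := by
  rwa [Ne, Set.smul_set_eq_univ]

variable [DecidableEq α]

theorem H_ne_empty (u : α × Bool) : H u ≠ ∅ :=
  (Set.nonempty_iff_ne_empty.1 ⟨lt u, by simp⟩)

theorem H_ne_univ (u : α × Bool) : H u ≠ Set.univ := by
  intro h
  have : (1 : FreeGroup α) ∈ H u := h ▸ Set.mem_univ _
  simp at this

theorem aN_H_bar (w : FreeGroup α) (u : α × Bool) : aN w (H (bar u)) = aN w (H u) := by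
  rw [H_bar, aN_smul, aN_compl]

theorem aN_union_parity {F : Type} [Group F] (w : F) {X Y : Set F} (hX : AI X) (hY : AI Y)
    (hd : Disjoint X Y) : (aN w (X ∪ Y) : ZMod 2) = aN w X + aN w Y := by
  have h : jump w (X ∪ Y) = (jump w X \ jump w Y) ∪ (jump w Y \ jump w X) := by
    ext g
    have h1 : g ∈ X → g ∉ Y := fun h => Set.disjoint_left.1 hd h
    have h2 : g * w ∈ X → g * w ∉ Y := fun h => Set.disjoint_left.1 hd h
    simp only [mem_jump, Set.mem_union, Set.mem_sdiff]
    tauto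
  have hX' := hX w
  have hY' := hY w
  have e1 := Set.ncard_union_eq (s := jump w X \ jump w Y) (t := jump w Y \ jump w X)
    (Set.disjoint_left.2 fun g hg hg' => hg.2 hg'.1) hX'.sdiff hY'.sdiff
  have e2 := Set.ncard_inter_add_ncard_sdiff_eq_ncard (jump w X) (jump w Y) hX'
  have e3 := Set.ncard_inter_add_ncard_sdiff_eq_ncard (jump w Y) (jump w X) hY'
  rw [Set.inter_comm] at e3
  have e : aN w (X ∪ Y) + 2 * (jump w X ∩ jump w Y).ncard = aN w X + aN w Y := by
    simp only [aN, h]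
    omega
  have := congrArg (Nat.cast (R := ZMod 2)) e
  push_cast at this
  rw [← this]
  have h2 : (2 : ZMod 2) = 0 := by decide
  rw [h2, zero_mul, add_zero]

theorem aN_S_parity (w : FreeGroup α) (B : Finset (α × Bool)) :
    (aN w (S (some '' (B : Set (α × Bool)))) : ZMod 2) = ∑ u ∈ B, (aN w (H u) : ZMod 2) := by
  induction B using Finset.induction_on with
  | empty =>
    have : jump w (S (∅ : Set (Option (α × Bool)))) = ∅ := by
      ext; simp [mem_jump]
    simp [aN, this]
  | insert u B hu ih =>
    rw [Finset.sum_insert hu, ← ih, ← aN_union_parity w (AI_H u) (AI_S _), H, ← S_union,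
      Finset.coe_insert, Set.image_insert_eq, Set.insert_eq]
    rw [Set.disjoint_left]
    intro g hg hg'
    obtain ⟨v, hv, hvg⟩ := hg'
    rw [mem_H] at hg
    rw [hg, Option.some_inj] at hvg
    exact hu (hvg ▸ hv)

theorem exists_separated_odd [Fintype α] (w : FreeGroup α) {B : Set (Option (α × Bool))}
    (hB : none ∉ B) (h : (aN w (S B) : ZMod 2) ≠ 0) :
    ∃ u, some u ∈ B ∧ some (bar u) ∉ B ∧ aN w (H u) ≠ 0 := by
  classical
  by_contra! hc
  apply h
  have hBe : B = some '' ((Finset.univ.filter fun u => some u ∈ B : Finset (α × Bool)) :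
      Set (α × Bool)) := by
    ext o
    cases o <;> simp [hB]
  rw [hBe, aN_S_parity, ← Finset.sum_filter_ne_zero]
  refine Finset.sum_involution (fun u _ => bar u) ?_ ?_ ?_ ?_
  · intro u _
    rw [aN_H_bar]
    exact CharTwo.add_self_eq_zero _
  · intro u _ _
    exact bar_ne u
  · intro u hu
    simp only [Finset.mem_filter, Finset.mem_univ, true_and] at hu ⊢
    rw [aN_H_bar]
    refine ⟨?_, hu.2⟩
    by_contra hn
    exact hu.2 (by rw [hc u hu.1 hn, Nat.cast_zero])
  · intro u _
    exact bar_bar u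

end Parity

section Nielsen

variable {α : Type} [DecidableEq α] [Fintype α]

/-- No Whitehead automorphism lowers the letter cost. -/
def LetterMin (φ : MulAut (FreeGroup α)) : Prop :=
  ∀ A a, some a ∈ A → some (bar a) ∉ A →
    (letterCost α).N (φ • H a) ≤ (letterCost α).N (φ • S A)

/-- No Whitehead automorphism that keeps the letter cost lowers the ball costs. -/
def BallMin (φ : MulAut (FreeGroup α)) : Prop :=
  ∀ A a, some a ∈ A → some (bar a) ∉ A →
    (letterCost α).N (φ • S A) ≤ (letterCost α).N (φ • H a) →
    (∀ r, (ballCost α r).N (φ • S A) ≤ (ballCost α r).N (φ • H a)) →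
    ∀ r, (ballCost α r).N (φ • H a) ≤ (ballCost α r).N (φ • S A)

theorem HS.letterCost {R : Set (FreeGroup α)} (h : HS R) : (letterCost α).N R = 1 := by
  obtain ⟨i, hi⟩ := h.exists_aN
  simp [Whitehead.letterCost, jumpCost_N, hi]

theorem HS_of_letterCost {R : Set (FreeGroup α)} (hR : Whitehead.AI R) (h0 : R ≠ ∅)
    (h1 : R ≠ Set.univ) (h : (letterCost α).N R < 2) : HS R := by
  refine HS_of_sum_le hR h0 h1 ?_
  rw [Whitehead.letterCost, jumpCost_N] at h
  have : ∑ i, aN (FreeGroup.of i) R < 2 := by exact_mod_cast h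
  omega

theorem HS_of_S {φ : MulAut (FreeGroup α)} (hφ : LetterMin φ) {B : Set (Option (α × Bool))}
    (hB : none ∉ B) (h : HS (φ • S B)) : HS (S B) := by
  obtain ⟨i, hi⟩ := h.exists_aN
  obtain ⟨u, hu, hu', hau⟩ := exists_separated_odd (φ⁻¹ (FreeGroup.of i)) hB (by
    rw [← aN_aut, hi, if_pos rfl]; decide)
  have h1 := hφ B u hu hu'
  rw [h.letterCost] at h1
  have h2 : HS (φ • H u) := HS_of_letterCost ((AI_H u).aut φ) (smul_ne_empty (H_ne_empty u))
    (smul_ne_univ (H_ne_univ u)) (by linarith)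
  obtain ⟨g, hg⟩ := h.eq_or h2 (i := i) (by rw [hi, if_pos rfl]; decide) (by rwa [aN_aut])
  rw [← Set.smul_set_compl] at hg
  have hg' : ∀ X : Set (FreeGroup α), φ • S B = g • φ • X → S B = φ⁻¹ g • X := fun X h => by
    rw [← inv_smul_smul φ (S B), h, aut_smul_smul, inv_smul_smul]
  have hH : HS (H u) := ⟨1, u, (one_smul _ _).symm⟩
  rcases hg with hg | hg
  · rw [hg' _ hg]; exact hH.smul _
  · rw [hg' _ hg]; exact hH.compl.smul _

/-- A set that is constant on all half-spaces at the identity but one cannot be mixed on the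
remaining one. -/
theorem not_mixed {φ : MulAut (FreeGroup α)} (hφ : LetterMin φ) (hφ' : BallMin φ)
    {K : Set (FreeGroup α)} (hK : HS (φ • K)) {a b : α × Bool}
    (hc : ∀ u, u ≠ a → ∀ z ∈ H u, z ∈ K ↔ lt u ∈ K)
    (hb : b ≠ a) (hb1 : ¬((1 : FreeGroup α) ∈ K ↔ lt b ∈ K)) {z z' : FreeGroup α}
    (hz : z ∈ H a) (hzK : z ∈ K) (hz' : z' ∈ H a) (hzK' : z' ∉ K) (ha : lt (bar a) ∈ K) :
    False := by
  let A : Set (Option (α × Bool)) := {o | o ≠ some a ∧ (o.elim 1 lt : FreeGroup α) ∈ K}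
  have hA : S A = K ∩ (H a)ᶜ := by
    ext g
    simp only [mem_S, A, Set.mem_ofPred_eq, Set.mem_inter_iff, Set.mem_compl_iff, mem_H]
    rcases hg : hd g with _ | u
    · rw [hd_eq_none.1 hg]; simp
    · simp only [Option.some.injEq, Option.elim_some, ne_eq]
      constructor
      · rintro ⟨h1, h2⟩; exact ⟨(hc u h1 g hg).2 h2, h1⟩
      · rintro ⟨h1, h2⟩; exact ⟨h2, (hc u h2 g hg).1 h1⟩
  have hmem : some (bar a) ∈ A := ⟨by simpa using bar_ne a, ha⟩
  have hnmem : some (bar (bar a)) ∉ A := by simp [A]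
  have hKAI : AI K := by
    have := hK.AI.aut φ⁻¹
    rwa [inv_smul_smul] at this
  have hHa : AI (H a)ᶜ := (AI_H a).compl
  have hT : K ∪ (H a)ᶜ = (Kᶜ ∩ H a)ᶜ := by rw [Set.compl_inter, compl_compl]
  have hsub : ∀ c : Cost (FreeGroup α) ℝ,
      c.N (φ • S A) + c.N (φ • (Kᶜ ∩ H a)) ≤ c.N (φ • K) + c.N (φ • H a) := fun c => by
    have := (c.pull φ).submod _ _ hKAI hHa
    rw [← hA, hT, Cost.compl, Cost.compl] at this
    exact this
  have hbarN : ∀ c : Cost (FreeGroup α) ℝ, c.N (φ • H (bar a)) = c.N (φ • H a) := fun c =>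
    (c.pull φ).N_H_bar a
  have h1 := hφ A (bar a) hmem hnmem
  rw [hbarN] at h1
  have h2 := hsub (letterCost α)
  rw [hK.letterCost] at h2
  have hTHS : HS (φ • (Kᶜ ∩ H a)) := by
    refine HS_of_letterCost ((hKAI.compl.inter (AI_H a)).aut φ)
      (smul_ne_empty (Set.nonempty_iff_ne_empty.1 ⟨z', hzK', hz'⟩)) (smul_ne_univ ?_)
      (by linarith)
    intro h
    have : z ∈ Kᶜ ∩ H a := h ▸ Set.mem_univ z
    exact this.1 hzK
  rw [hTHS.letterCost] at h2
  have h3 : ∀ r, (ballCost α r).N (φ • S A) ≤ (ballCost α r).N (φ • H (bar a)) := fun r => by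
    have := hsub (ballCost α r)
    rw [ballCost_HS r hTHS hK] at this
    rw [hbarN]
    linarith
  have h4 := hφ' A (bar a) hmem hnmem (by rw [hbarN]; linarith) h3
  obtain ⟨p, hpK, hpa⟩ : ∃ p, p ∉ K ∧ p ∉ H a := by
    by_cases h : (1 : FreeGroup α) ∈ K
    · exact ⟨lt b, fun h' => hb1 (iff_of_true h h'), by simpa using hb⟩
    · exact ⟨1, h, by simp⟩
  have h5 := aN_submod_strict (hKAI.aut φ) (hHa.aut φ) (p := φ p) (q := φ z)
    ⟨Set.smul_mem_smul_set hpa, fun h => hpK (Set.smul_mem_smul_set_iff.1 h)⟩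
    ⟨Set.smul_mem_smul_set hzK, fun h => (Set.smul_mem_smul_set_iff.1 h) hz⟩
  rw [← Set.smul_set_inter, ← Set.smul_set_union, ← hA, hT, Set.smul_set_compl, aN_compl,
    Set.smul_set_compl, aN_compl] at h5
  set w := (φ p)⁻¹ * φ z
  have h6 := h4 w.norm
  rw [hbarN] at h6
  have h7 := ballCost_HS w.norm hTHS hK
  have h8 : (ballCost α w.norm).N (φ • S A) + (ballCost α w.norm).N (φ • (Kᶜ ∩ H a)) <
      (ballCost α w.norm).N (φ • K) + (ballCost α w.norm).N (φ • H a) := by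
    simp only [ballCost, jumpCost_N, id]
    rw [← Nat.cast_add, ← Nat.cast_add, Nat.cast_lt, ← Finset.sum_add_distrib,
      ← Finset.sum_add_distrib]
    refine Finset.sum_lt_sum (fun v _ => ?_) ⟨w, by simp, h5⟩
    have := aN_submod v (hKAI.aut φ) (hHa.aut φ)
    rwa [← Set.smul_set_inter, ← Set.smul_set_union, ← hA, hT, Set.smul_set_compl, aN_compl,
      Set.smul_set_compl, aN_compl] at this
  linarith

end Nielsen

end Whitehead

namespace Whitehead

open Pointwise

section Nielsen

variable {α : Type} [DecidableEq α]

theorem norm_mul_of_hd {v z : FreeGroup α} (h : hd v⁻¹ ≠ hd z) :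
    (v * z).norm = v.norm + z.norm := by
  have hred : FreeGroup.IsReduced (v.toWord ++ z.toWord) := by
    refine List.isChain_append.2 ⟨FreeGroup.isReduced_toWord, FreeGroup.isReduced_toWord, ?_⟩
    intro x hx y hy hxy
    by_contra hc
    apply h
    have h1 : hd v⁻¹ = (v.toWord.getLast?).map bar := by
      rw [hd, FreeGroup.toWord_inv, FreeGroup.invRev, List.head?_reverse, List.getLast?_map]
      rfl
    rw [h1, hd, hy, hx, Option.map_some]
    obtain ⟨i, b⟩ := x
    obtain ⟨j, c⟩ := y
    cases b <;> cases c <;> simp_all [bar]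
  rw [FreeGroup.norm, FreeGroup.toWord_mul, hred.reduce_eq, List.length_append]
  rfl

theorem norm_lt (u : α × Bool) : (lt u).norm = 1 := by
  simp [FreeGroup.norm, lt, FreeGroup.toWord_mk]

theorem norm_mul_lt_of_hd {v : FreeGroup α} {u : α × Bool} (h : hd v⁻¹ = some u) :
    (v * lt u).norm < v.norm := by
  have h1 : FreeGroup.mk v⁻¹.toWord = v⁻¹ := FreeGroup.mk_toWord
  have h2 : v⁻¹.toWord.length = v.norm := FreeGroup.norm_inv_eq
  rw [hd] at h
  obtain ⟨l, hl⟩ := List.head?_eq_some_iff.1 h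
  rw [hl, ← lt_mul_mk] at h1
  have h3 : (v * lt u) = (FreeGroup.mk l)⁻¹ := by
    rw [eq_inv_iff_mul_eq_one, mul_assoc, h1, mul_inv_cancel]
  rw [h3, FreeGroup.norm_inv_eq, ← h2, hl, List.length_cons]
  exact Nat.lt_succ_of_le FreeGroup.norm_mk_le

theorem isReduced_toWord_of_hd {z : FreeGroup α} {u : α × Bool} (h : hd z = some u) :
    ∃ l, FreeGroup.IsReduced (u :: l) ∧ z = FreeGroup.mk (u :: l) := by
  obtain ⟨l, hl⟩ := List.head?_eq_some_iff.1 h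
  exact ⟨l, hl ▸ FreeGroup.isReduced_toWord, by rw [← hl, FreeGroup.mk_toWord]⟩

/-- At a farthest jump, a set is constant on all half-spaces pointing away from the identity. -/
theorem exists_far_vertex {K : Set (FreeGroup α)} [Finite α] (hK : AI K) (h0 : K ≠ ∅)
    (h1 : K ≠ Set.univ) : ∃ (v : FreeGroup α) (b : α × Bool), hd v⁻¹ ≠ some b ∧
      ¬((1 : FreeGroup α) ∈ v⁻¹ • K ↔ lt b ∈ v⁻¹ • K) ∧
      ∀ u, hd v⁻¹ ≠ some u → ∀ z ∈ H u, z ∈ v⁻¹ • K ↔ lt u ∈ v⁻¹ • K := by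
  let D : Set (FreeGroup α) := ⋃ s, jump (lt s) K
  have hD : D.Finite := Set.finite_iUnion fun s => hK _
  have hbar : ∀ {h s}, h ∈ jump (lt s) K → h * lt s ∈ jump (lt (bar s)) K := fun {h s} hs => by
    rw [mem_jump] at hs ⊢
    rw [lt_bar, mul_inv_cancel_right]
    tauto
  have hDn : D.Nonempty := by
    obtain ⟨i, hi⟩ := exists_aN_ne_zero hK h0 h1
    obtain ⟨x, hx⟩ := Set.nonempty_of_ncard_ne_zero hi
    exact ⟨x, Set.mem_iUnion.2 ⟨(i, true), hx⟩⟩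
  obtain ⟨g, hg, hmax⟩ := Set.exists_max_image D FreeGroup.norm hD hDn
  obtain ⟨s, hs⟩ := Set.mem_iUnion.1 hg
  set v := g * lt s with hv
  have hgv : g = v * lt (bar s) := by rw [hv, lt_bar, mul_inv_cancel_right]
  have hvD : v ∈ D := Set.mem_iUnion.2 ⟨_, hbar hs⟩
  have hb : hd v⁻¹ ≠ some (bar s) := fun h => by
    have h2 := norm_mul_lt_of_hd h
    rw [← hgv] at h2
    exact absurd (hmax v hvD) (not_le.2 h2)
  have hn : g.norm = v.norm + 1 := by
    rw [hgv, norm_mul_of_hd (by rwa [hd_lt]), norm_lt]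
  have hmem : ∀ z, z ∈ v⁻¹ • K ↔ v * z ∈ K := fun z => by
    rw [Set.mem_smul_set_iff_inv_smul_mem, inv_inv, smul_eq_mul]
  refine ⟨v, bar s, hb, ?_, ?_⟩
  · rw [hmem, hmem, mul_one, ← hgv]
    rw [mem_jump, ← hv] at hs
    tauto
  · intro u hu z hz
    obtain ⟨l, hl, rfl⟩ := isReduced_toWord_of_hd hz
    rw [hmem, hmem]
    clear hz
    induction l using List.reverseRecOn with
    | nil => rfl
    | append_singleton l t ih =>
      have hl' : FreeGroup.IsReduced (u :: l) := ((isReduced_concat (l := u :: l)).1 hl).1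
      rw [← ih hl', ← List.cons_append, ← mk_mul_lt, ← mul_assoc]
      by_contra hc
      have h2 : v * FreeGroup.mk (u :: l) * lt t ∈ D :=
        Set.mem_iUnion.2 ⟨_, hbar (s := t) (by rw [mem_jump]; tauto)⟩
      have h3 := hmax _ h2
      rw [mul_assoc, mk_mul_lt, norm_mul_of_hd, hn, FreeGroup.norm, FreeGroup.norm,
        toWord_mk_of_isReduced (by simpa using hl)] at h3
      · simp at h3
      · rw [hd_mk (by simpa using hl)]
        simpa using hu

variable [Fintype α]

theorem HS_of_smul_aut {φ : MulAut (FreeGroup α)} (hφ : LetterMin φ) (hφ' : BallMin φ)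
    {K : Set (FreeGroup α)} (hK : HS (φ • K)) : HS K := by
  have hAI : AI K := by
    have := hK.AI.aut φ⁻¹
    rwa [inv_smul_smul] at this
  have h0 : K ≠ ∅ ∧ K ≠ Set.univ := by
    obtain ⟨g, u, h⟩ := hK
    constructor
    · rintro rfl
      rw [Set.smul_set_empty] at h
      exact H_ne_empty u (Set.smul_set_eq_empty.1 h.symm)
    · rintro rfl
      rw [Set.smul_set_univ] at h
      exact H_ne_univ u (Set.smul_set_eq_univ.1 h.symm)
  obtain ⟨v, b, hb, hb1, hc⟩ := exists_far_vertex hAI h0.1 h0.2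
  have hK1 : HS (φ • v⁻¹ • K) := by
    rw [aut_smul_smul]; exact hK.smul _
  apply HS.of_smul (g := v⁻¹)
  generalize v⁻¹ • K = K1 at *
  by_cases hall : ∀ u, ∀ z ∈ H u, z ∈ K1 ↔ lt u ∈ K1
  · let B : Set (Option (α × Bool)) := {o | (o.elim 1 lt : FreeGroup α) ∈ K1}
    have hB : K1 = S B := by
      ext g
      rw [mem_S]
      rcases hg : hd g with _ | u
      · rw [hd_eq_none.1 hg]; rfl
      · exact hall u g hg
    rw [hB] at hK1 ⊢
    by_cases hn : none ∈ B
    · apply HS.of_compl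
      rw [← S_compl]
      refine HS_of_S hφ (not_not.2 hn) ?_
      rw [S_compl, Set.smul_set_compl]
      exact hK1.compl
    · exact HS_of_S hφ hn hK1
  · push Not at hall
    obtain ⟨a, z, hz, hza⟩ := hall
    have ha : hd v⁻¹ = some a := by
      by_contra h
      have := hc a h z hz
      tauto
    have hc' : ∀ u, u ≠ a → ∀ z ∈ H u, z ∈ K1 ↔ lt u ∈ K1 := fun u hu =>
      hc u (by rw [ha]; simpa using hu.symm)
    have hba : b ≠ a := fun h => hb (by rw [ha, h])
    have hla : lt a ∈ H a := by simp
    exfalso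
    have key : ∀ K1 : Set (FreeGroup α), HS (φ • K1) →
        (∀ u, u ≠ a → ∀ z ∈ H u, z ∈ K1 ↔ lt u ∈ K1) →
        ¬((1 : FreeGroup α) ∈ K1 ↔ lt b ∈ K1) → ¬(z ∈ K1 ↔ lt a ∈ K1) → lt (bar a) ∈ K1 →
        False := by
      intro K1 hK1 hc hb1 hza hba'
      by_cases hzK : z ∈ K1
      · exact not_mixed hφ hφ' hK1 hc hba hb1 hz hzK hla (by tauto) hba'
      · exact not_mixed hφ hφ' hK1 hc hba hb1 hla (by tauto) hz hzK hba'
    by_cases hba' : lt (bar a) ∈ K1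
    · exact key K1 hK1 hc' hb1 (by tauto) hba'
    · refine key K1ᶜ (by rw [Set.smul_set_compl]; exact hK1.compl) (fun u hu z hz => ?_) ?_ ?_ hba'
      · exact not_congr (hc' u hu z hz)
      · simp only [Set.mem_compl_iff]; tauto
      · simp only [Set.mem_compl_iff]; tauto

theorem mem_signedPerm_of_min {φ : MulAut (FreeGroup α)} (hφ : LetterMin φ) (hφ' : BallMin φ) :
    φ ∈ SignedPerm := by
  have hHS : ∀ u, HS (φ⁻¹ • H u) := fun u =>
    HS_of_smul_aut hφ hφ' (by rw [smul_inv_smul]; exact ⟨1, u, (one_smul _ _).symm⟩)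
  have htype : ∀ i, ∃ u : α × Bool, ∀ j, aN (φ⁻¹ (FreeGroup.of j)) (H u) =
      if j = i then 1 else 0 := fun i => by
    obtain ⟨g, u, hu⟩ := hHS (i, true)
    refine ⟨u, fun j => ?_⟩
    have : φ • H u = (φ g)⁻¹ • H (i, true) := by
      rw [eq_inv_smul_iff, ← aut_smul_smul, ← hu, smul_inv_smul]
    rw [← aN_aut, this, aN_smul, aN_of_H]
  choose t ht using htype
  have ht' : ∀ i u, u.1 = (t i).1 → ∀ j, aN (φ⁻¹ (FreeGroup.of j)) (H u) =
      if j = i then 1 else 0 := fun i u hu j => by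
    rw [← ht i j]
    by_cases h : u = t i
    · rw [h]
    · have h : u = bar (t i) := by
        obtain ⟨i, b⟩ := u
        generalize t _ = s at *
        obtain ⟨j, c⟩ := s
        cases b <;> cases c <;> simp_all [bar]
      rw [h, aN_H_bar]
  have hinj : Function.Injective fun i => (t i).1 := by
    intro i j hij
    have h1 := ht i i
    rw [ht' j (t i) hij, if_pos rfl] at h1
    by_contra h
    rw [if_neg h] at h1
    exact absurd h1 (by decide)
  have hbij : Function.Bijective fun i => (t i).1 := Finite.injective_iff_bijective.1 hinj
  have hnorm : ∀ j, (φ⁻¹ (FreeGroup.of j)).norm = 1 := fun j => by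
    have hne : φ⁻¹ (FreeGroup.of j) ≠ 1 := by
      rw [Ne, map_eq_one_iff _ (MulEquiv.injective _)]
      exact FreeGroup.of_ne_one j
    have h1 := norm_lt_sum_aN hne
    have h3 : ∑ u, aN (φ⁻¹ (FreeGroup.of j)) (H u) = ∑ i, if j = i then 2 else 0 := by
      rw [Fintype.sum_prod_type,
        ← hbij.sum_comp fun i => ∑ b, aN (φ⁻¹ (FreeGroup.of j)) (H (i, b))]
      refine Finset.sum_congr rfl fun i _ => ?_
      rw [Fintype.sum_bool, ht' i (_, true) rfl, ht' i (_, false) rfl]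
      split_ifs <;> rfl
    rw [h3, Finset.sum_ite_eq, if_pos (Finset.mem_univ _)] at h1
    have h2 : (φ⁻¹ (FreeGroup.of j)).norm ≠ 0 := fun h => hne (FreeGroup.norm_eq_zero.1 h)
    omega
  have hlt : ∀ u : α × Bool, ∃ v : α × Bool, φ⁻¹ (lt u) = lt v := by
    have h1 : ∀ j, ∃ v : α × Bool, φ⁻¹ (FreeGroup.of j) = lt v := fun j => by
      obtain ⟨v, hv⟩ := List.length_eq_one_iff.1 (hnorm j)
      exact ⟨v, by rw [lt, ← hv, FreeGroup.mk_toWord]⟩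
    rintro ⟨j, b⟩
    obtain ⟨v, hv⟩ := h1 j
    cases b
    · exact ⟨bar v, by rw [lt_false, map_inv, hv, lt_bar]⟩
    · exact ⟨v, hv⟩
  choose π hπ using hlt
  have hπi : Function.Injective π := fun u v h => lt_injective
    ((MulEquiv.injective φ⁻¹) (by rw [hπ, hπ, h]))
  rw [← inv_mem_iff]
  exact ⟨Equiv.ofBijective π (Finite.injective_iff_bijective.1 hπi), hπ⟩

theorem Cost.val_mul_wh {Γ : Type} [AddCommGroup Γ] [LinearOrder Γ] (c : Cost (FreeGroup α) Γ)
    (φ : MulAut (FreeGroup α)) {A : Set (Option (α × Bool))} {a : α × Bool} (ha : some a ∈ A)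
    (ha' : some (bar a) ∉ A) : c.val (φ * wh A a) =
      c.val φ - (c.N (φ • H a) + c.N (φ • H a)) + (c.N (φ • S A) + c.N (φ • S A)) := by
  have := (c.pull φ).val_wh ha ha'
  rwa [Cost.val_pull, Cost.val_pull, mul_one] at this

/-- Every automorphism is a product of Whitehead automorphisms and signed permutations. -/
theorem edge_connected [Nonempty α] (φ : MulAut (FreeGroup α)) :
    Relation.ReflTransGen Edge φ 1 := by
  have hfin : ∀ x, ({ψ | Relation.ReflTransGen Edge φ ψ} ∩
      {ψ | (letterCost α).val ψ ≤ x}).Finite := fun x => (finite_letterCost_le x).inter_of_right _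
  obtain ⟨ψ₀, ⟨hψ₀, hle⟩, hmin⟩ := Set.exists_min_image _ (letterCost α).val
    (hfin ((letterCost α).val φ)) ⟨φ, Relation.ReflTransGen.refl, le_refl ((letterCost α).val φ)⟩
  have hmin' : ∀ ψ, Relation.ReflTransGen Edge φ ψ →
      (letterCost α).val ψ₀ ≤ (letterCost α).val ψ := fun ψ hψ => by
    rcases le_total ((letterCost α).val ψ) ((letterCost α).val φ) with h | h
    · exact hmin ψ ⟨hψ, h⟩
    · exact hle.trans h
  obtain ⟨ψ, ⟨hψ, hψle⟩, hψmin⟩ := (hfin ((letterCost α).val ψ₀)).exists_minimalFor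
    (fun ψ (r : ℕ) => (ballCost α r).val ψ) _ ⟨ψ₀, hψ₀, le_refl ((letterCost α).val ψ₀)⟩
  have hmem : ∀ A a, Relation.ReflTransGen Edge φ (ψ * wh A a) := fun A a =>
    hψ.tail ⟨A, a, 1, one_mem _, (mul_one _).symm⟩
  have hσ : ψ ∈ SignedPerm := by
    refine mem_signedPerm_of_min (fun A a ha ha' => ?_) fun A a ha ha' h hb r => ?_
    · have h1 := hψle.trans (hmin' _ (hmem A a))
      rw [Cost.val_mul_wh _ ψ ha ha'] at h1
      linarith
    · have h1 : (letterCost α).val (ψ * wh A a) ≤ (letterCost α).val ψ₀ := by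
        refine le_trans ?_ hψle
        rw [Cost.val_mul_wh _ ψ ha ha']
        linarith
      have h2 := hψmin ⟨hmem A a, h1⟩ (fun r => by
        dsimp only
        rw [Cost.val_mul_wh _ ψ ha ha']
        linarith [hb r]) r
      dsimp only at h2
      rw [Cost.val_mul_wh _ ψ ha ha'] at h2
      linarith
  refine hψ.tail ?_
  simpa using (edge_of_signedPerm (1 : MulAut (FreeGroup α)) hσ).symm

end Nielsen

end Whitehead

namespace Whitehead

open Pointwise Filter Topology

/-! ### Asymptotic jump rates and conjugacy classes -/

section Rate

variable {F : Type} [Group F]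

/-- The asymptotic number of jumps per power of `w`. -/
noncomputable def rate (w : F) (R : Set F) : ℝ :=
  sInf ((fun n : ℕ => (aN (w ^ n) R : ℝ) / n) '' Set.Ici 1)

theorem tendsto_rate (w : F) {R : Set F} (hR : AI R) :
    Tendsto (fun n : ℕ => (aN (w ^ n) R : ℝ) / n) atTop (𝓝 (rate w R)) := by
  have h : Subadditive fun n : ℕ => (aN (w ^ n) R : ℝ) := fun m n => by
    dsimp only
    rw [pow_add]
    exact_mod_cast aN_mul_le _ _ hR
  have e : h.lim = rate w R := by rw [Subadditive.lim, rate]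
  rw [← e]
  exact h.tendsto_lim ⟨0, by rintro _ ⟨n, rfl⟩; positivity⟩

theorem rate_nonneg (w : F) (R : Set F) : 0 ≤ rate w R := by
  apply Real.sInf_nonneg
  rintro _ ⟨n, -, rfl⟩
  positivity

theorem rate_smul (w g : F) (R : Set F) : rate w (g • R) = rate w R := by
  simp only [rate, aN_smul]

theorem rate_compl (w : F) (R : Set F) : rate w Rᶜ = rate w R := by
  simp only [rate, aN_compl]

theorem rate_aut (φ : MulAut F) (w : F) (R : Set F) : rate w (φ • R) = rate (φ⁻¹ w) R := by
  simp only [rate, aN_aut, map_pow]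

theorem rate_submod (w : F) {A B : Set F} (hA : AI A) (hB : AI B) :
    rate w (A ∩ B) + rate w (A ∪ B) ≤ rate w A + rate w B := by
  refine le_of_tendsto_of_tendsto' ((tendsto_rate w (hA.inter hB)).add
    (tendsto_rate w (hA.union hB))) ((tendsto_rate w hA).add (tendsto_rate w hB)) fun n => ?_
  rw [← add_div, ← add_div]
  exact div_le_div_of_nonneg_right (by exact_mod_cast aN_submod _ hA hB) (Nat.cast_nonneg n)

theorem rate_conj (w h : F) {R : Set F} (hR : AI R) : rate (h * w * h⁻¹) R = rate w R := by
  have key : ∀ w h : F, rate (h * w * h⁻¹) R ≤ rate w R := fun w h => by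
    have h1 := (tendsto_rate w hR).add (tendsto_const_div_atTop_nhds_zero_nat (2 * aN h R : ℝ))
    rw [add_zero] at h1
    refine le_of_tendsto_of_tendsto' (tendsto_rate _ hR) h1 fun n => ?_
    rw [← add_div, conj_pow]
    gcongr
    exact_mod_cast aN_conj_le _ h hR
  refine (key w h).antisymm ?_
  have := key (h * w * h⁻¹) h⁻¹
  rwa [inv_inv, show h⁻¹ * (h * w * h⁻¹) * h = w by group] at this

/-- The asymptotic jump rate of a conjugacy class. -/
noncomputable def crate (C : ConjClasses F) (R : Set F) : ℝ := rate C.out R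

theorem crate_mk (w : F) {R : Set F} (hR : AI R) : crate (ConjClasses.mk w) R = rate w R := by
  have h : ConjClasses.mk (ConjClasses.mk w).out = ConjClasses.mk w := Quotient.out_eq _
  obtain ⟨c, hc⟩ := isConj_iff.1 (ConjClasses.mk_eq_mk_iff_isConj.1 h)
  have e := rate_conj (ConjClasses.mk w).out c hR
  rw [hc] at e
  exact e.symm

theorem crate_aut (φ : MulAut F) (C : ConjClasses F) {R : Set F} (hR : AI R) :
    crate C (φ • R) = crate (ConjClasses.map φ⁻¹.toMonoidHom C) R := by
  obtain ⟨w, rfl⟩ := ConjClasses.exists_rep C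
  rw [crate_mk w (hR.aut φ), rate_aut, ← crate_mk _ hR]
  rfl

/-- The cost of a marking consisting of an element and finitely many conjugacy classes. -/
noncomputable def markCost (w : F) (𝒞 : Finset (ConjClasses F)) : Cost F ℝ where
  N R := aN w R + ∑ C ∈ 𝒞, crate C R
  smul g R := by simp only [crate, rate_smul, aN_smul]
  compl R := by simp only [crate, rate_compl, aN_compl]
  submod A B hA hB := by
    have h1 : (aN w (A ∩ B) : ℝ) + aN w (A ∪ B) ≤ aN w A + aN w B := by
      exact_mod_cast aN_submod w hA hB
    have h2 := Finset.sum_le_sum fun C (_ : C ∈ 𝒞) => rate_submod C.out hA hB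
    rw [Finset.sum_add_distrib, Finset.sum_add_distrib] at h2
    unfold crate
    linarith

/-- The marking of the free group transported by an automorphism. -/
def mark (w : F) (𝒞 : Set (ConjClasses F)) (φ : MulAut F) : F × Set (ConjClasses F) :=
  (φ⁻¹ w, ConjClasses.map φ⁻¹.toMonoidHom '' 𝒞)

theorem map_map (φ ψ : MulAut F) (C : ConjClasses F) :
    ConjClasses.map φ.toMonoidHom (ConjClasses.map ψ.toMonoidHom C) =
      ConjClasses.map (φ * ψ).toMonoidHom C := by
  obtain ⟨w, rfl⟩ := ConjClasses.exists_rep C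
  rfl

theorem map_one_aut (C : ConjClasses F) :
    ConjClasses.map (1 : MulAut F).toMonoidHom C = C := by
  obtain ⟨w, rfl⟩ := ConjClasses.exists_rep C
  rfl

theorem image_map_map (φ ψ : MulAut F) (𝒞 : Set (ConjClasses F)) :
    ConjClasses.map φ.toMonoidHom '' (ConjClasses.map ψ.toMonoidHom '' 𝒞) =
      ConjClasses.map (φ * ψ).toMonoidHom '' 𝒞 := by
  simp only [Set.image_image, map_map]

theorem image_map_one (𝒞 : Set (ConjClasses F)) :
    ConjClasses.map (1 : MulAut F).toMonoidHom '' 𝒞 = 𝒞 := by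
  simp only [map_one_aut, Set.image_id']

theorem map_injective (φ : MulAut F) :
    Function.Injective (ConjClasses.map φ.toMonoidHom) :=
  Function.LeftInverse.injective (g := ConjClasses.map φ⁻¹.toMonoidHom) fun C => by
    rw [map_map, inv_mul_cancel, map_one_aut]

theorem mark_mul {w : F} {𝒞 : Set (ConjClasses F)} {g : MulAut F} (hw : g w = w)
    (h𝒞 : ConjClasses.map g.toMonoidHom '' 𝒞 = 𝒞) (φ : MulAut F) :
    mark w 𝒞 (g * φ) = mark w 𝒞 φ := by
  have h1 : g⁻¹ w = w := by
    conv_lhs => rw [← hw]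
    exact MulAut.inv_apply_self _ _ _
  have h2 : ConjClasses.map g⁻¹.toMonoidHom '' 𝒞 = 𝒞 := by
    conv_lhs => rw [← h𝒞]
    rw [image_map_map, inv_mul_cancel, image_map_one]
  rw [mark, mark, mul_inv_rev, ← image_map_map, h2, MulAut.mul_apply, h1]

theorem of_mark_eq {w : F} {𝒞 : Set (ConjClasses F)} {φ ψ : MulAut F}
    (h : mark w 𝒞 φ = mark w 𝒞 ψ) : (φ * ψ⁻¹) w = w ∧
      ConjClasses.map (φ * ψ⁻¹).toMonoidHom '' 𝒞 = 𝒞 := by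
  obtain ⟨h1, h2⟩ := Prod.mk.inj h
  constructor
  · rw [MulAut.mul_apply, ← h1]; exact MulAut.apply_inv_self _ _ _
  · rw [← image_map_map, ← h2, image_map_map, mul_inv_cancel, image_map_one]

end Rate

section RateFree

variable {α : Type} [DecidableEq α]

theorem exists_cyclicallyReduced (C : ConjClasses (FreeGroup α)) :
    ∃ w : FreeGroup α, ConjClasses.mk w = C ∧ FreeGroup.IsCyclicallyReduced w.toWord := by
  obtain ⟨g, rfl⟩ := ConjClasses.exists_rep C
  have h1 := FreeGroup.reduceCyclically.isCyclicallyReduced (FreeGroup.isReduced_toWord (x := g))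
  refine ⟨FreeGroup.mk (FreeGroup.reduceCyclically g.toWord), ?_, ?_⟩
  · rw [ConjClasses.mk_eq_mk_iff_isConj, isConj_iff]
    refine ⟨FreeGroup.mk (FreeGroup.reduceCyclically.conjugator g.toWord), ?_⟩
    rw [FreeGroup.inv_mk, FreeGroup.mul_mk, FreeGroup.mul_mk,
      FreeGroup.reduceCyclically.conj_conjugator_reduceCyclically, FreeGroup.mk_toWord]
  · rwa [toWord_mk_of_isReduced h1.isReduced]

theorem norm_pow_of_cyclicallyReduced {w : FreeGroup α}
    (hw : FreeGroup.IsCyclicallyReduced w.toWord) (n : ℕ) : (w ^ n).norm = n * w.norm := by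
  rw [FreeGroup.norm, FreeGroup.toWord_pow, (hw.flatten_replicate n).isReduced.reduce_eq]
  simp [FreeGroup.norm]

variable [Fintype α]

theorem norm_le_sum_rate {w : FreeGroup α} (hw : FreeGroup.IsCyclicallyReduced w.toWord) :
    (w.norm : ℝ) ≤ ∑ u, rate w (H u) := by
  have h := tendsto_finsetSum (Finset.univ : Finset (α × Bool)) fun u _ =>
    tendsto_rate w (AI_H u)
  refine ge_of_tendsto h (eventually_atTop.2 ⟨1, fun n hn => ?_⟩)
  rw [← Finset.sum_div, le_div_iff₀ (by positivity)]
  have := norm_le_sum_aN (w ^ n)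
  rw [norm_pow_of_cyclicallyReduced hw] at this
  rw [mul_comm]
  exact_mod_cast this

theorem markCost_val (w : FreeGroup α) (𝒞 : Finset (ConjClasses (FreeGroup α)))
    (φ : MulAut (FreeGroup α)) : (markCost w 𝒞).val φ =
      ∑ u, ((aN (mark w 𝒞 φ).1 (H u) : ℝ) + ∑ᶠ C ∈ (mark w 𝒞 φ).2, crate C (H u)) := by
  refine Finset.sum_congr rfl fun u _ => ?_
  simp only [mark, markCost, aN_aut]
  rw [finsum_mem_image (map_injective _).injOn, finsum_mem_coe_finset]
  simp only [crate_aut φ _ (AI_H u)]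

theorem finite_mark (w : FreeGroup α) (𝒞 : Finset (ConjClasses (FreeGroup α))) (x : ℝ) :
    (mark w 𝒞 '' {φ | (markCost w 𝒞).val φ ≤ x}).Finite := by
  obtain ⟨n, hn⟩ := exists_nat_ge x
  have hB := finite_norm_le (α := α) n
  refine (hB.prod (hB.image ConjClasses.mk).finite_subsets).subset ?_
  rintro _ ⟨φ, hφ, rfl⟩
  rw [Set.mem_ofPred_eq, markCost_val, Finset.sum_add_distrib] at hφ
  have h0 : ∀ u, 0 ≤ ∑ᶠ C ∈ (mark w 𝒞 φ).2, crate C (H u) := fun u =>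
    finsum_mem_induction (0 ≤ ·) le_rfl (fun _ _ => add_nonneg) fun C _ => rate_nonneg _ _
  have h1 : (0 : ℝ) ≤ ∑ u, (aN (mark w 𝒞 φ).1 (H u) : ℝ) := by positivity
  have h2 := Finset.sum_nonneg fun u (_ : u ∈ (Finset.univ : Finset (α × Bool))) => h0 u
  refine ⟨?_, fun C hC => ?_⟩
  · have := norm_le_sum_aN (mark w 𝒞 φ).1
    have h3 : ((mark w 𝒞 φ).1.norm : ℝ) ≤ ∑ u, (aN (mark w 𝒞 φ).1 (H u) : ℝ) := by
      exact_mod_cast this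
    have h4 : ((mark w 𝒞 φ).1.norm : ℝ) ≤ n := by linarith
    exact_mod_cast h4
  · obtain ⟨v, rfl, hv⟩ := exists_cyclicallyReduced C
    refine ⟨v, ?_, rfl⟩
    have h3 := norm_le_sum_rate hv
    have hf : (mark w 𝒞 φ).2.Finite := (Finset.finite_toSet 𝒞).image _
    have h4 : ∑ u, rate v (H u) ≤ ∑ u, ∑ᶠ C ∈ (mark w 𝒞 φ).2, crate C (H u) := by
      refine Finset.sum_le_sum fun u _ => ?_
      rw [← crate_mk v (AI_H u), finsum_mem_eq_finite_toFinset_sum _ hf]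
      exact Finset.single_le_sum (f := fun C => crate C (H u)) (fun C _ => rate_nonneg _ _)
        (hf.mem_toFinset.2 hC)
    have h5 : (v.norm : ℝ) ≤ n := by linarith
    exact_mod_cast h5

end RateFree

end Whitehead

namespace Whitehead

open Pointwise

/-! ### Stabilizers of markings are finitely presented -/

theorem reflTransGen_symm {V : Type} {r : V → V → Prop} (hr : ∀ u v, r u v → r v u) {u v : V}
    (h : Relation.ReflTransGen r u v) : Relation.ReflTransGen r v u := by
  induction h with
  | refl => exact .refl
  | tail _ h ih => exact .head (hr _ _ h) ih

section Lex

variable {F : Type} [Group F]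

/-- The lexicographic combination of two costs. -/
noncomputable def Cost.lex (c d : Cost F ℝ) : Cost F (ℝ ×ₗ ℝ) where
  N R := toLex (c.N R, d.N R)
  smul g R := by rw [c.smul, d.smul]
  compl R := by rw [c.compl, d.compl]
  submod A B hA hB := Prod.Lex.toLex_mono
    (show (c.N (A ∩ B), d.N (A ∩ B)) + (c.N (A ∪ B), d.N (A ∪ B)) ≤
      (c.N A, d.N A) + (c.N B, d.N B) from ⟨c.submod A B hA hB, d.submod A B hA hB⟩)

end Lex

section Stabilizer

variable {α : Type} [DecidableEq α]

/-- The products of a Whitehead automorphism and a signed permutation. -/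
def edgeSet (α : Type) [DecidableEq α] : Set (MulAut (FreeGroup α)) :=
  {e | ∃ A a, ∃ σ ∈ SignedPerm, e = wh A a * σ}

theorem edge_eq : (Edge : MulAut (FreeGroup α) → MulAut (FreeGroup α) → Prop) =
    fun u v => u⁻¹ * v ∈ edgeSet α := by
  funext u v
  refine propext (exists_congr fun A => exists_congr fun a => exists_congr fun σ =>
    and_congr_right fun _ => ?_)
  rw [inv_mul_eq_iff_eq_mul, mul_assoc]

variable [Fintype α]

theorem Cost.lex_val (c d : Cost (FreeGroup α) ℝ) (φ : MulAut (FreeGroup α)) :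
    (c.lex d).val φ = toLex (c.val φ, d.val φ) := by
  have h := map_sum (toLexAddEquiv (ℝ × ℝ))
    (fun u => (c.N (φ • H u), d.N (φ • H u))) (Finset.univ : Finset (α × Bool))
  refine h.symm.trans (congrArg toLex ?_)
  exact Prod.ext (Prod.fst_sum ..) (Prod.snd_sum ..)

theorem finite_signedPerm : (SignedPerm (α := α) : Set (MulAut (FreeGroup α))).Finite :=
  (finite_letterCost_le ((letterCost α).val 1)).subset fun σ hσ => by
    have := (letterCost α).val_mul_signedPerm 1 hσ
    rw [one_mul] at this
    exact this.le

theorem finite_edgeSet : (edgeSet α).Finite := by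
  refine ((Set.finite_range fun x : Set (Option (α × Bool)) × (α × Bool) => wh x.1 x.2).mul
    finite_signedPerm).subset ?_
  rintro _ ⟨A, a, σ, hσ, rfl⟩
  exact Set.mul_mem_mul ⟨(A, a), rfl⟩ hσ

variable (w : FreeGroup α) (𝒞 : Finset (ConjClasses (FreeGroup α)))

/-- The cost of a marking, with ties broken by the letter cost. -/
noncomputable def fullCost : Cost (FreeGroup α) (ℝ ×ₗ ℝ) := (markCost w 𝒞).lex (letterCost α)

variable {w 𝒞}

theorem fullCost_le_iff {φ ψ : MulAut (FreeGroup α)} :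
    (fullCost w 𝒞).val φ ≤ (fullCost w 𝒞).val ψ ↔
      (markCost w 𝒞).val φ < (markCost w 𝒞).val ψ ∨
      (markCost w 𝒞).val φ = (markCost w 𝒞).val ψ ∧
        (letterCost α).val φ ≤ (letterCost α).val ψ := by
  rw [fullCost, Cost.lex_val, Cost.lex_val, Prod.Lex.toLex_le_toLex]

theorem markCost_le {φ ψ : MulAut (FreeGroup α)}
    (h : (fullCost w 𝒞).val φ ≤ (fullCost w 𝒞).val ψ) :
    (markCost w 𝒞).val φ ≤ (markCost w 𝒞).val ψ :=
  (fullCost_le_iff.1 h).elim le_of_lt fun h => h.1.le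

variable (w 𝒞) in
theorem wellFounded_fullCost :
    WellFounded fun φ ψ => (fullCost w 𝒞).val φ < (fullCost w 𝒞).val ψ := by
  refine WellFounded.wellFounded_iff_has_min.2 fun s ⟨φ₀, hφ₀⟩ => ?_
  have h1 : ((markCost w 𝒞).val '' {φ | (markCost w 𝒞).val φ ≤ (markCost w 𝒞).val φ₀}).Finite := by
    refine ((finite_mark w 𝒞 ((markCost w 𝒞).val φ₀)).image fun m =>
      ∑ u, ((aN m.1 (H u) : ℝ) + ∑ᶠ C ∈ m.2, crate C (H u))).subset ?_
    rintro _ ⟨φ, hφ, rfl⟩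
    exact ⟨_, ⟨φ, hφ, rfl⟩, (markCost_val w 𝒞 φ).symm⟩
  obtain ⟨_, ⟨φ₁, ⟨hφ₁, hle₁⟩, rfl⟩, hmin₁⟩ := Set.exists_min_image
    ((markCost w 𝒞).val '' (s ∩ {φ | (markCost w 𝒞).val φ ≤ (markCost w 𝒞).val φ₀})) id
    (h1.subset (Set.image_mono Set.inter_subset_right))
    ⟨_, φ₀, ⟨hφ₀, le_refl ((markCost w 𝒞).val φ₀)⟩, rfl⟩
  have hmin : ∀ φ ∈ s, (markCost w 𝒞).val φ₁ ≤ (markCost w 𝒞).val φ := fun φ hφ => by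
    rcases le_total ((markCost w 𝒞).val φ) ((markCost w 𝒞).val φ₀) with h | h
    · exact hmin₁ _ ⟨φ, ⟨hφ, h⟩, rfl⟩
    · exact le_trans hle₁ h
  obtain ⟨φ₂, ⟨⟨hφ₂, heq⟩, hle₂⟩, hmin₂⟩ := Set.exists_min_image
    ((s ∩ {φ | (markCost w 𝒞).val φ = (markCost w 𝒞).val φ₁}) ∩
      {φ | (letterCost α).val φ ≤ (letterCost α).val φ₁}) (letterCost α).val
    ((finite_letterCost_le _).inter_of_right _) ⟨φ₁, ⟨hφ₁, rfl⟩, le_refl ((letterCost α).val φ₁)⟩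
  rw [Set.mem_ofPred_eq] at heq hle₂
  refine ⟨φ₂, hφ₂, fun φ hφ => not_lt.2 (fullCost_le_iff.2 ?_)⟩
  rcases (hmin φ hφ).lt_or_eq with h | h
  · exact .inl (heq.trans_lt h)
  · refine .inr ⟨heq.trans h, ?_⟩
    rcases le_total ((letterCost α).val φ) ((letterCost α).val φ₁) with h' | h'
    · exact hmin₂ φ ⟨⟨hφ, h.symm⟩, h'⟩
    · exact hle₂.trans h'

theorem finite_fullCost_le {φ₀ : MulAut (FreeGroup α)}
    (h : ∀ φ, (fullCost w 𝒞).val φ₀ ≤ (fullCost w 𝒞).val φ) :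
    {φ | (fullCost w 𝒞).val φ ≤ (fullCost w 𝒞).val φ₀}.Finite :=
  (finite_letterCost_le ((letterCost α).val φ₀)).subset fun φ hφ => by
    rcases fullCost_le_iff.1 hφ with h' | h'
    · exact absurd (markCost_le (h φ)) h'.not_ge
    · exact h'.2

theorem reflTransGen_edge [Nonempty α] (φ ψ : MulAut (FreeGroup α)) :
    Relation.ReflTransGen Edge φ ψ :=
  (edge_connected φ).trans
    (reflTransGen_symm (fun _ _ => Edge.symm) (edge_connected ψ))

/-- The stabilizer of an element and a finite set of conjugacy classes of a free group of finite
rank is finitely presented. -/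
theorem isFinitelyPresented_stabilizer [Nonempty α] (w : FreeGroup α)
    (𝒞 : Finset (ConjClasses (FreeGroup α))) (G : Subgroup (MulAut (FreeGroup α)))
    (hG : ∀ φ, φ ∈ G ↔ φ w = w ∧
      ConjClasses.map φ.toMonoidHom '' (𝒞 : Set (ConjClasses (FreeGroup α))) = 𝒞) :
    Group.IsFinitelyPresented G := by
  have hf := wellFounded_fullCost w 𝒞
  set f := (fullCost w 𝒞).val
  obtain ⟨φ₀, -, hmin⟩ := hf.has_min Set.univ ⟨1, trivial⟩
  have hb : ∀ φ, f φ₀ ≤ f φ := fun φ => not_lt.1 (hmin φ trivial)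
  set P : MulAut (FreeGroup α) → Prop := fun φ =>
    (markCost w 𝒞).val φ ≤ (markCost w 𝒞).val φ₀
  have hP : ∀ u v, P v → f u ≤ f v → P u := fun u v hv h => (markCost_le h).trans hv
  have hmark : ∀ g ∈ G, ∀ φ, mark w 𝒞 (g * φ) = mark w 𝒞 φ := fun g hg φ =>
    mark_mul ((hG g).1 hg).1 ((hG g).1 hg).2 φ
  have hs : ∀ u v : MulAut (FreeGroup α), Edge u v → Edge v u := fun _ _ => Edge.symm
  have hp : HasPeaks Edge f 6 := fun _ _ _ => peak _
  have hfin := finite_fullCost_le hb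
  obtain ⟨D, hD⟩ := hp.exists_diam hs hf hb (reflTransGen_edge φ₀) hfin
  have hinv : ∀ φ, mark w 𝒞 (Function.invFun (mark w 𝒞) (mark w 𝒞 φ)) = mark w 𝒞 φ := fun φ =>
    Function.invFun_eq ⟨φ, rfl⟩
  have hfrom : ∀ v, P v → Relation.ReflTransGen (Within Edge P) φ₀ v := fun v hv =>
    Within.mono (fun u hu => hP u v hv hu) (hp.within hs hf hb (reflTransGen_edge φ₀ v))
  have hsymm : ∀ u v, Within Edge P u v → Within Edge P v u :=
    fun u v h => ⟨h.1.symm, h.2.2, h.2.1⟩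
  refine isFinitelyPresented_of_potential (finite_edgeSet (α := α)) G (P := P)
    (ρ := fun φ => Function.invFun (mark w 𝒞) (mark w 𝒞 φ)) (v₀ := φ₀)
    (le_refl ((markCost w 𝒞).val φ₀)) (fun g hg u hu => ?_)
    (fun u _ => (hG _).2 (of_mark_eq (hinv u).symm)) (fun g hg u _ => ?_) ?_ ?_
    (L := 6 + 2 * D + 2) ?_
  · change (markCost w 𝒞).val (g * u) ≤ _
    rwa [markCost_val, hmark g hg, ← markCost_val]
  · rw [hmark g hg]
  · have := (finite_mark w 𝒞 ((markCost w 𝒞).val φ₀)).image (Function.invFun (mark w 𝒞))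
    rwa [Set.image_image] at this
  · rw [← edge_eq]
    exact fun u v hu hv => (reflTransGen_symm hsymm (hfrom u hu)).trans (hfrom v hv)
  · rw [← edge_eq]
    intro K _ η h1
    obtain ⟨F, hF⟩ := exists_potential hp hs hf hP (le_refl ((markCost w 𝒞).val φ₀))
      (fun v hv => hp.exists_lower hs hf hb (reflTransGen_edge φ₀ v) hv) hD h1
    refine ⟨F, fun u v hu hv h => hF u v hu hv ?_⟩
    rwa [edge_eq]

end Stabilizer

end Whitehead

/-- `AM_{g,1,p}` is finitely presented: there are a finite generating set (indexed by
`Fin m` for some `m`) and a finite set of relations presenting it. -/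
theorem AM_finitely_presented (g p : ℕ)
    (AM : Subgroup (MulAut (FreeGroup (Fin (2 * g + p)))))
    (hAM : (AM : Set (MulAut (FreeGroup (Fin (2 * g + p))))) = AMcarrier g p) :
    ∃ (m : ℕ) (rels : Finset (FreeGroup (Fin m))),
      Nonempty (PresentedGroup (rels : Set (FreeGroup (Fin m))) ≃* AM) := by
  have hmem : ∀ φ, φ ∈ AM ↔ φ (boundaryWord g p) = boundaryWord g p ∧
      ConjClasses.map φ.toMonoidHom '' punctureClasses g p = punctureClasses g p := fun φ => by
    rw [← SetLike.mem_coe, hAM]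
    rfl
  have hfp : Group.IsFinitelyPresented AM := by
    rcases Nat.eq_zero_or_pos (2 * g + p) with h0 | h0
    · have : IsEmpty (Fin (2 * g + p)) := by rw [h0]; infer_instance
      have : Finite (MulAut (FreeGroup (Fin (2 * g + p)))) :=
        Finite.of_injective (fun φ : MulAut (FreeGroup (Fin (2 * g + p))) => ⇑φ)
          DFunLike.coe_injective
      infer_instance
    · have : Nonempty (Fin (2 * g + p)) := ⟨⟨0, h0⟩⟩
      have hfin : (punctureClasses g p).Finite := Set.finite_range _
      refine Whitehead.isFinitelyPresented_stabilizer (boundaryWord g p) hfin.toFinset AM fun φ => ?_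
      rw [hmem, hfin.coe_toFinset]
  obtain ⟨m, rels, hrels, ⟨e⟩⟩ := Group.IsFinitelyPresented.exists_mulEquiv_presentedGroup (G := AM)
  refine ⟨m, hrels.toFinset, ⟨?_⟩⟩
  rw [hrels.coe_toFinset]
  exact e.symm
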